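/- For every ε > 0 there exists a constant C(ε) > 0 such that for every odd prime p, the quadratic character χ modulo p (i.e., the nonprincipal character with χ² = χ₀), and every real x ≥ 2, one has | ∑_{m ≤ x, m square-full} χ(m) − (L(3/2, χ)/ζ(3)) · (1 + 1/p + 1/p²)^{-1} · x^{1/2} | ≤ C(ε) · x^{1/4} · (log x)^{1/2} · p^{3/32+ε}, where L(s, χ) is the Dirichlet L-function of χ. -/

import Mathlib

/-- A positive integer `n` is square-full if every prime `q` dividing `n` satisfies `q^2 ∣ n`. -/
def Squarefull (n : ℕ) : Prop := ∀ q : ℕ, q.Prime → q ∣ n → q ^ 2 ∣ n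

section Stepanov

open Polynomial

variable {F : Type*} [Field F]

/-- The linear operators `D` for which the `k`-th derivative of `f ^ e * r` is
`f ^ (e - k) * D r`. -/
noncomputable def derivCofactor (f : F[X]) (e : ℕ) : ℕ → (F[X] →ₗ[F] F[X])
  | 0 => LinearMap.id
  | k + 1 =>
    LinearMap.mulLeft F (((e - k : ℕ) : F[X]) * derivative f) ∘ₗ derivCofactor f e k
      + LinearMap.mulLeft F f ∘ₗ derivative ∘ₗ derivCofactor f e k

theorem derivCofactor_succ (f r : F[X]) (e k : ℕ) :
    derivCofactor f e (k + 1) r = ((e - k : ℕ) : F[X]) * derivative f * derivCofactor f e k r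
      + f * derivative (derivCofactor f e k r) := by
  simp [derivCofactor, mul_assoc]

theorem iterate_derivative_pow_mul_mul_X_pow (p : ℕ) [CharP F p] (f r : F[X]) (e j k : ℕ)
    (hk : k ≤ e) :
    derivative^[k] (f ^ e * r * X ^ (j * p)) =
      f ^ (e - k) * derivCofactor f e k r * X ^ (j * p) := by
  induction k with
  | zero => simp [derivCofactor]
  | succ k ih =>
    rw [Function.iterate_succ_apply', ih (by omega), derivCofactor_succ]
    have hX : derivative (X ^ (j * p) : F[X]) = 0 := by
      simp [derivative_X_pow]
    have h : e - k = (e - (k + 1)) + 1 := by omega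
    rw [derivative_mul, derivative_mul, hX, derivative_pow, h]
    simp only [Nat.add_sub_cancel, map_natCast]
    ring

theorem natDegree_derivCofactor_le {f : F[X]} {m : ℕ} (hf : f.natDegree ≤ m + 1) (r : F[X])
    (e k : ℕ) : (derivCofactor f e k r).natDegree ≤ r.natDegree + m * k := by
  induction k with
  | zero => simp [derivCofactor]
  | succ k ih =>
    rw [derivCofactor_succ]
    refine natDegree_add_le_of_degree_le ?_ ?_
    · refine natDegree_mul_le.trans ?_
      have h1 : (((e - k : ℕ) : F[X]) * derivative f).natDegree ≤ m := by
        refine natDegree_mul_le.trans ?_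
        have := natDegree_derivative_le f
        simp only [natDegree_natCast]
        omega
      rw [Nat.mul_succ]
      omega
    · by_cases h0 : (derivCofactor f e k r).natDegree = 0
      · rw [derivative_of_natDegree_zero h0]; simp
      · refine natDegree_mul_le.trans ?_
        have := natDegree_derivative_lt h0
        rw [Nat.mul_succ]
        omega

theorem eq_zero_of_sq_mul_eq {f r s : F[X]} {α b : F} (hα : Odd (f.rootMultiplicity α))
    (hb : b ≠ 0) (h : r ^ 2 * f = s ^ 2 * C b) : r = 0 ∧ s = 0 := by
  have hf : f ≠ 0 := by rintro rfl; simp at hα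
  have hC : (C b : F[X]) ≠ 0 := by simpa using hb
  by_cases hr : r = 0
  · subst hr
    have : s ^ 2 * C b = 0 := by rw [← h]; simp
    simpa [hb] using this
  · exfalso
    have hs : s ≠ 0 := by
      rintro rfl
      have : r ^ 2 * f = 0 := by rw [h]; simp
      simp [hr, hf] at this
    have h1 := congrArg (rootMultiplicity α) h
    rw [rootMultiplicity_mul (mul_ne_zero (pow_ne_zero _ hr) hf),
      rootMultiplicity_mul (mul_ne_zero (pow_ne_zero _ hs) hC), rootMultiplicity_C, sq, sq,
      rootMultiplicity_mul (mul_ne_zero hr hr), rootMultiplicity_mul (mul_ne_zero hs hs)] at h1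
    obtain ⟨k, hk⟩ := hα
    omega

theorem eq_zero_of_sum_add_mul_pow_eq_zero {p : ℕ} [Fact p.Prime] {f : (ZMod p)[X]}
    {α : ZMod p} {c m n : ℕ} (hα : Odd (f.rootMultiplicity α)) (h0 : f.eval 0 ≠ 0)
    (hc : 2 * c + 1 = p) (hf : f.natDegree ≤ m) (hn : 2 * n + m < p) (J : ℕ)
    (r s : ℕ → (ZMod p)[X]) (hr : ∀ j < J, (r j).natDegree ≤ n) (hs : ∀ j < J, (s j).natDegree ≤ n)
    (h : ∑ j ∈ Finset.range J, (r j + s j * f ^ c) * X ^ (j * p) = 0) :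
    ∀ j < J, r j = 0 ∧ s j = 0 := by
  induction J generalizing r s with
  | zero => simp
  | succ J ih =>
    have hX : (X ^ p : (ZMod p)[X]) ≠ 0 := pow_ne_zero _ X_ne_zero
    rw [Finset.sum_range_succ'] at h
    have hshift : ∑ j ∈ Finset.range J, (r (j + 1) + s (j + 1) * f ^ c) * X ^ ((j + 1) * p)
        = X ^ p * ∑ j ∈ Finset.range J, (r (j + 1) + s (j + 1) * f ^ c) * X ^ (j * p) := by
      rw [Finset.mul_sum]
      refine Finset.sum_congr rfl fun j _ => ?_
      rw [add_one_mul j p, pow_add]; ring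
    have hsplit : ∑ j ∈ Finset.range J, (r (j + 1) + s (j + 1) * f ^ c) * X ^ (j * p)
        = (∑ j ∈ Finset.range J, r (j + 1) * X ^ (j * p))
          + (∑ j ∈ Finset.range J, s (j + 1) * X ^ (j * p)) * f ^ c := by
      rw [Finset.sum_mul, ← Finset.sum_add_distrib]
      refine Finset.sum_congr rfl fun j _ => ?_
      ring
    have hzero : r 0 = 0 ∧ s 0 = 0 := by
      rw [hshift, hsplit] at h
      set R := ∑ j ∈ Finset.range J, r (j + 1) * X ^ (j * p)
      set S := ∑ j ∈ Finset.range J, s (j + 1) * X ^ (j * p)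
      have h1 : r 0 + X ^ p * R = -((s 0 + X ^ p * S) * f ^ c) := by
        simp only [zero_mul, pow_zero, mul_one] at h
        linear_combination h
      have h2 : (r 0 + X ^ p * R) ^ 2 * f = (s 0 + X ^ p * S) ^ 2 * f ^ p := by
        have hp : f ^ p = f ^ (2 * c + 1) := by rw [hc]
        rw [h1, hp]; ring
      obtain ⟨g, hg⟩ : ∃ g, f ^ p = C (f.eval 0) + X ^ p * g := by
        refine ⟨expand (ZMod p) p f.divX, ?_⟩
        rw [← ZMod.expand_card]
        conv_lhs => rw [← divX_mul_X_add f]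
        rw [map_add, map_mul, expand_X, expand_C, coeff_zero_eq_eval_zero]
        ring
      have h3 : X ^ p ∣ r 0 ^ 2 * f - s 0 ^ 2 * C (f.eval 0) := by
        refine ⟨-(2 * r 0 * R * f + X ^ p * R ^ 2 * f) + (2 * s 0 * S + X ^ p * S ^ 2) * f ^ p
          + s 0 ^ 2 * g, ?_⟩
        linear_combination h2 + s 0 ^ 2 * hg
      have h4 : r 0 ^ 2 * f - s 0 ^ 2 * C (f.eval 0) = 0 := by
        refine eq_zero_of_dvd_of_natDegree_lt h3 ?_
        rw [natDegree_X_pow]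
        refine lt_of_le_of_lt (natDegree_sub_le_of_le (m := 2 * n + m) (n := 2 * n + m) ?_ ?_) ?_
        · exact natDegree_mul_le_of_le
            (natDegree_pow_le_of_le 2 (hr 0 (by omega))) hf
        · exact natDegree_mul_le_of_le
            (natDegree_pow_le_of_le 2 (hs 0 (by omega))) (by simp)
        · simpa using hn
      exact eq_zero_of_sq_mul_eq hα h0 (sub_eq_zero.1 h4)
    have hrest := ih (fun j => r (j + 1)) (fun j => s (j + 1)) (fun j hj => hr _ (by omega))
      (fun j hj => hs _ (by omega)) (by
        rw [hshift, hzero.1, hzero.2] at h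
        simpa [hX] using h)
    intro j hj
    cases j with
    | zero => exact hzero
    | succ j => exact hrest j (by omega)

theorem card_mul_le_natDegree_of_le_rootMultiplicity {h : F[X]} (S : Finset F)
    {l : ℕ} (hS : ∀ x ∈ S, l ≤ h.rootMultiplicity x) : S.card * l ≤ h.natDegree := by
  classical
  have h1 : l • S.val ≤ h.roots := by
    rw [Multiset.le_iff_count]
    intro x
    rw [Multiset.count_nsmul, count_roots]
    by_cases hx : x ∈ S
    · rw [Multiset.count_eq_one_of_mem S.nodup hx]; simpa using hS x hx
    · rw [Multiset.count_eq_zero_of_notMem hx]; simp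
  have h2 := (Multiset.card_le_card h1).trans h.card_roots'
  rw [Multiset.card_nsmul] at h2
  simpa [mul_comm] using h2

theorem exists_small_kernel_polynomials (f : F[X]) (hf : f.natDegree ≤ 4) (a : F)
    {l c d J : ℕ} (hd : 0 < d) (hdim : l * (d + 3 * l + J) < J * (d + d)) :
    ∃ r s : ℕ → F[X], (∀ j, (r j).natDegree ≤ d - 1) ∧ (∀ j, (s j).natDegree ≤ d - 1) ∧
      (∃ j < J, r j ≠ 0 ∨ s j ≠ 0) ∧
      ∀ i < l, ∑ j ∈ Finset.range J, (derivCofactor f l i (r j)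
        + C a * derivCofactor f (l + c) i (s j)) * X ^ j = 0 := by
  let V := Fin J → (degreeLT F d × degreeLT F d)
  let σ (i : ℕ) : V →ₗ[F] F[X] := ∑ j : Fin J, LinearMap.mulRight F (X ^ (j : ℕ)) ∘ₗ
    (derivCofactor f l i ∘ₗ (degreeLT F d).subtype ∘ₗ LinearMap.fst F _ _
      + a • (derivCofactor f (l + c) i ∘ₗ (degreeLT F d).subtype ∘ₗ LinearMap.snd F _ _))
      ∘ₗ LinearMap.proj j
  let Φ : V →ₗ[F] (Fin l → Fin (d + 3 * l + J) → F) :=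
    LinearMap.pi fun i => LinearMap.pi fun n => lcoeff F n ∘ₗ σ i
  have hfin : Module.finrank F (degreeLT F d) = d := by
    rw [(degreeLTEquiv F d).finrank_eq]; simp
  have : Module.Finite F (degreeLT F d) := Module.Finite.equiv (degreeLTEquiv F d).symm
  have hker : LinearMap.ker Φ ≠ ⊥ := by
    apply LinearMap.ker_ne_bot_of_finrank_lt
    simpa [V, Module.finrank_pi_fintype, hfin] using hdim
  obtain ⟨v, hv, hv0⟩ := (Submodule.ne_bot_iff _).1 hker
  have hdeg : ∀ q : degreeLT F d, (q : F[X]).natDegree ≤ d - 1 := by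
    intro q
    by_cases h0 : (q : F[X]) = 0
    · simp [h0]
    · have := (natDegree_lt_iff_degree_lt h0).2 (mem_degreeLT.1 q.2)
      omega
  have hr : ∀ j, (if h : j < J then ((v ⟨j, h⟩).1 : F[X]) else 0).natDegree ≤ d - 1 := by
    intro j; split_ifs
    · exact hdeg _
    · simp
  have hs : ∀ j, (if h : j < J then ((v ⟨j, h⟩).2 : F[X]) else 0).natDegree ≤ d - 1 := by
    intro j; split_ifs
    · exact hdeg _
    · simp
  refine ⟨fun j => if h : j < J then ((v ⟨j, h⟩).1 : F[X]) else 0,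
    fun j => if h : j < J then ((v ⟨j, h⟩).2 : F[X]) else 0, hr, hs, ?_, ?_⟩
  · obtain ⟨j, hj⟩ := Function.ne_iff.1 hv0
    refine ⟨j, j.2, ?_⟩
    by_contra! hcon
    apply hj
    ext1
    · simpa using! hcon.1
    · simpa using! hcon.2
  · intro i hi
    have hσ : σ i v = ∑ j ∈ Finset.range J,
        (derivCofactor f l i (if h : j < J then ((v ⟨j, h⟩).1 : F[X]) else 0)
        + C a * derivCofactor f (l + c) i (if h : j < J then ((v ⟨j, h⟩).2 : F[X]) else 0))
          * X ^ j := by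
      rw [Finset.sum_range]
      simp [σ, smul_eq_C_mul]
      rfl
    rw [← hσ]
    ext n
    by_cases hn : n < d + 3 * l + J
    · have := congrFun (congrFun (LinearMap.mem_ker.1 hv) ⟨i, hi⟩) ⟨n, hn⟩
      simpa [Φ] using this
    · rw [coeff_zero]
      apply coeff_eq_zero_of_natDegree_lt
      rw [hσ]
      refine lt_of_le_of_lt (natDegree_sum_le_of_forall_le (n := d - 1 + 3 * i + (J - 1))
        _ _ ?_) (by omega)
      intro j hj
      have hj := Finset.mem_range.1 hj
      refine natDegree_mul_le.trans ?_
      rw [natDegree_X_pow]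
      refine add_le_add (natDegree_add_le_of_degree_le ?_ ?_) (by omega)
      · exact (natDegree_derivCofactor_le hf _ _ _).trans (by have := hr j; omega)
      · refine (natDegree_C_mul_le _ _).trans ?_
        exact (natDegree_derivCofactor_le hf _ _ _).trans (by have := hs j; omega)

end Stepanov

section Stepanov

open Polynomial

variable {p : ℕ} [Fact p.Prime]

theorem card_mul_le_of_eval_pow_eq {f : (ZMod p)[X]} (hf : f.natDegree ≤ 4) (h0 : f.eval 0 ≠ 0)
    {α : ZMod p} (hα : Odd (f.rootMultiplicity α)) {c k : ℕ} (hc : 2 * c + 1 = p) (hk : 2 ≤ k)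
    (hkp : (2 * k) ^ 2 ≤ p) (a : ZMod p) (S : Finset (ZMod p))
    (hS : ∀ x ∈ S, f.eval x ≠ 0 ∧ f.eval x ^ c = a) :
    S.card * (2 * k) ≤ k * p + 9 * p + 8 * k := by
  have hf0 : f ≠ 0 := by rintro rfl; simp at hα
  have hck : 2 * k ^ 2 ≤ c := by nlinarith
  have hk2 : 2 * k ≤ k ^ 2 := by nlinarith
  obtain ⟨r, s, hr, hs, ⟨j₀, hj₀, hne⟩, hvan⟩ :=
    exists_small_kernel_polynomials f hf a (l := 2 * k) (c := c) (d := c - 1) (J := k + 7)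
      (by omega) (by
        obtain ⟨c', rfl⟩ : ∃ c', c = c' + 1 := ⟨c - 1, by omega⟩
        simp only [Nat.add_sub_cancel]
        nlinarith)
  set h : (ZMod p)[X] := ∑ j ∈ Finset.range (k + 7),
    (f ^ (2 * k) * r j * X ^ (j * p) + f ^ (2 * k + c) * s j * X ^ (j * p)) with hdef
  have hfac : h = f ^ (2 * k) * ∑ j ∈ Finset.range (k + 7), (r j + s j * f ^ c) * X ^ (j * p) := by
    rw [hdef, Finset.mul_sum]
    refine Finset.sum_congr rfl fun j _ => ?_
    ring
  have hne0 : h ≠ 0 := by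
    intro hz
    rw [hfac] at hz
    have := eq_zero_of_sum_add_mul_pow_eq_zero hα h0 hc hf (n := c - 1 - 1) (by omega) (k + 7) r s
      (fun j _ => hr j) (fun j _ => hs j) ((mul_eq_zero.1 hz).resolve_left (pow_ne_zero _ hf0))
      j₀ hj₀
    rcases hne with hne | hne
    · exact hne this.1
    · exact hne this.2
  have hmult : ∀ x ∈ S, 2 * k ≤ h.rootMultiplicity x := by
    intro x hx
    obtain ⟨hx0, hxa⟩ := hS x hx
    have hlt := lt_rootMultiplicity_of_isRoot_iterate_derivative_of_mem_nonZeroDivisors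
      (n := 2 * k - 1) (t := x) hne0 ?_ ?_
    · omega
    · intro i hi
      have hi' : i < 2 * k := by omega
      have hv := congrArg (eval x) (hvan i hi')
      rw [IsRoot, hdef, iterate_derivative_sum, eval_finsetSum]
      rw [eval_finsetSum, eval_zero] at hv
      rw [← mul_zero (f.eval x ^ (2 * k - i)), ← hv, Finset.mul_sum]
      refine Finset.sum_congr rfl fun j _ => ?_
      rw [iterate_map_add, iterate_derivative_pow_mul_mul_X_pow p f _ _ _ _ (by omega),
        iterate_derivative_pow_mul_mul_X_pow p f _ _ _ _ (by omega)]
      have hsub : 2 * k + c - i = (2 * k - i) + c := by omega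
      have hxp : x ^ (j * p) = x ^ j := by rw [pow_mul, ZMod.pow_card]
      simp only [eval_add, eval_mul, eval_pow, eval_X, eval_C, hxp, hsub, pow_add, hxa]
      ring
    · rw [mem_nonZeroDivisors_iff_ne_zero, Ne, ZMod.natCast_eq_zero_iff,
        (Fact.out : p.Prime).dvd_factorial]
      have : 2 * k ≤ (2 * k) ^ 2 := Nat.le_self_pow two_ne_zero _
      omega
  refine (card_mul_le_natDegree_of_le_rootMultiplicity S hmult).trans ?_
  refine (natDegree_sum_le_of_forall_le (n := 4 * (2 * k) + 4 * c + (c - 1 - 1) + (k + 6) * p)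
    _ _ ?_).trans ?_
  · intro j hj
    have hj := Finset.mem_range.1 hj
    have hjp : j * p ≤ (k + 6) * p := Nat.mul_le_mul_right _ (by omega)
    refine natDegree_add_le_of_degree_le ?_ ?_
    · refine (natDegree_mul_le_of_le (natDegree_mul_le_of_le (natDegree_pow_le_of_le _ hf) (hr j))
        (natDegree_X_pow_le _)).trans ?_
      omega
    · refine (natDegree_mul_le_of_le (natDegree_mul_le_of_le (natDegree_pow_le_of_le _ hf) (hs j))
        (natDegree_X_pow_le _)).trans ?_
      omega
  · have : (k + 6) * p = k * p + 6 * p := by ring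
    omega

theorem two_mul_card_le_of_eval_pow_eq (hp : 256 ≤ p) {f : (ZMod p)[X]} (hf : f.natDegree ≤ 4)
    (h0 : f.eval 0 ≠ 0)
    {α : ZMod p} (hα : Odd (f.rootMultiplicity α)) {c : ℕ} (hc : 2 * c + 1 = p)
    (a : ZMod p) (S : Finset (ZMod p)) (hS : ∀ x ∈ S, f.eval x ≠ 0 ∧ f.eval x ^ c = a) :
    2 * (S.card : ℝ) ≤ p + 28 * √p := by
  set k := Nat.sqrt p / 2 with hk
  have h16 : 16 ≤ Nat.sqrt p := Nat.le_sqrt.2 (by omega)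
  have hkp : (2 * k) ^ 2 ≤ p := by
    have h1 : 2 * k ≤ Nat.sqrt p := by omega
    calc (2 * k) ^ 2 ≤ Nat.sqrt p ^ 2 := Nat.pow_le_pow_left h1 2
      _ ≤ p := Nat.sqrt_le' p
  have hmain := card_mul_le_of_eval_pow_eq hf h0 hα hc (by omega) hkp a S hS
  have h8 : (8 : ℝ) ≤ k := by exact_mod_cast (by omega : 8 ≤ k)
  have hs16 : (16 : ℝ) ≤ √p := by
    apply Real.le_sqrt_of_sq_le
    have : (256 : ℝ) ≤ p := by exact_mod_cast hp
    linarith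
  have hsk : √p ≤ 2 * k + 2 := by
    apply Real.sqrt_le_iff.2 ⟨by positivity, ?_⟩
    have h1 : p < (Nat.sqrt p + 1) ^ 2 := Nat.lt_succ_sqrt' p
    have h2 : (Nat.sqrt p + 1) ^ 2 ≤ (2 * k + 2) ^ 2 := Nat.pow_le_pow_left (by omega) 2
    exact_mod_cast (h1.trans_le h2).le
  have hsq : √(p : ℝ) * √p = p := Real.mul_self_sqrt (by positivity)
  have hR : (S.card : ℝ) * (2 * k) ≤ k * p + 9 * p + 8 * k := by exact_mod_cast hmain
  have h3 : (p : ℝ) ≤ √p * (9 / 4 * k) := by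
    nlinarith
  have h4 : (k : ℝ) * (2 * S.card) ≤ k * (p + 28 * √p) := by nlinarith
  exact le_of_mul_le_mul_left h4 (by linarith)

theorem abs_sum_quadraticChar_eval_le (hp : p ≠ 2) {f : (ZMod p)[X]} (hf : f.natDegree ≤ 4)
    (h0 : f.eval 0 ≠ 0) {α : ZMod p} (hα : Odd (f.rootMultiplicity α)) :
    |((∑ x : ZMod p, quadraticChar (ZMod p) (f.eval x) : ℤ) : ℝ)| ≤ 32 * √p := by
  have hf0 : f ≠ 0 := by rintro rfl; simp at hα
  have hpodd : 2 * (p / 2) + 1 = p := by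
    have := ((Fact.out : p.Prime).eq_two_or_odd).resolve_left hp
    omega
  have hring : ringChar (ZMod p) ≠ 2 := by rwa [ZMod.ringChar_zmod_n]
  have hp1 : (1 : ℝ) ≤ p := by exact_mod_cast (Fact.out : p.Prime).one_lt.le
  rcases lt_or_ge p 256 with hlt | hge
  · have h1 : |((∑ x : ZMod p, quadraticChar (ZMod p) (f.eval x) : ℤ) : ℝ)| ≤ p := by
      rw [Int.cast_sum]
      refine (Finset.abs_sum_le_sum_abs _ _).trans ?_
      refine (Finset.sum_le_card_nsmul _ _ 1 ?_).trans ?_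
      · intro x _
        rcases quadraticChar_isQuadratic (ZMod p) (f.eval x) with h | h | h <;> simp [h]
      · simp [ZMod.card]
    have h2 : √(p : ℝ) ≤ 16 := by
      apply Real.sqrt_le_iff.2 ⟨by norm_num, ?_⟩
      have : (p : ℝ) ≤ 256 := by exact_mod_cast hlt.le
      linarith
    have hsq : √(p : ℝ) * √p = p := Real.mul_self_sqrt (by positivity)
    nlinarith [Real.sqrt_nonneg (p : ℝ)]
  · set χ := quadraticChar (ZMod p)
    set P : Finset (ZMod p) := Finset.univ.filter fun x => χ (f.eval x) = 1 with hP
    set N : Finset (ZMod p) := Finset.univ.filter fun x => χ (f.eval x) = -1 with hN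
    set Z : Finset (ZMod p) := Finset.univ.filter fun x => χ (f.eval x) = 0 with hZ
    have hpow : ∀ x, ((χ (f.eval x) : ℤ) : ZMod p) = f.eval x ^ (p / 2) := by
      intro x
      have := quadraticChar_eq_pow_of_char_ne_two' hring (f.eval x)
      rwa [ZMod.card] at this
    have hPb := two_mul_card_le_of_eval_pow_eq hge hf h0 hα hpodd 1 P (by
      intro x hx
      have hx : χ (f.eval x) = 1 := (Finset.mem_filter.1 hx).2
      refine ⟨fun hz => by simp [hz, χ] at hx, ?_⟩
      rw [← hpow, hx]; simp)
    have hNb := two_mul_card_le_of_eval_pow_eq hge hf h0 hα hpodd (-1) N (by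
      intro x hx
      have hx : χ (f.eval x) = -1 := (Finset.mem_filter.1 hx).2
      refine ⟨fun hz => by simp [hz, χ] at hx, ?_⟩
      rw [← hpow, hx]; simp)
    have hZb : Z.card ≤ 4 := by
      refine le_trans (Finset.card_le_card (t := f.roots.toFinset) ?_)
        ((Multiset.toFinset_card_le _).trans (f.card_roots'.trans hf))
      intro x hx
      have hx : χ (f.eval x) = 0 := (Finset.mem_filter.1 hx).2
      rw [Multiset.mem_toFinset, mem_roots hf0, IsRoot]
      exact quadraticChar_eq_zero_iff.1 hx
    have hval : ∀ x, χ (f.eval x) = (if χ (f.eval x) = 1 then 1 else 0)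
        - (if χ (f.eval x) = -1 then 1 else 0) := by
      intro x
      rcases quadraticChar_isQuadratic (ZMod p) (f.eval x) with h | h | h <;>
        simp only [χ, h] <;> norm_num
    have hone : ∀ x, (1 : ℤ) = (if χ (f.eval x) = 1 then 1 else 0)
        + (if χ (f.eval x) = -1 then 1 else 0) + (if χ (f.eval x) = 0 then 1 else 0) := by
      intro x
      rcases quadraticChar_isQuadratic (ZMod p) (f.eval x) with h | h | h <;>
        simp only [χ, h] <;> norm_num
    have hsum : ∑ x : ZMod p, χ (f.eval x) = (P.card : ℤ) - N.card := by
      rw [Finset.sum_congr rfl fun x _ => hval x, Finset.sum_sub_distrib]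
      simp [hP, hN]
    have hcard : (p : ℤ) = P.card + N.card + Z.card := by
      have h1 : (p : ℤ) = ∑ x : ZMod p, 1 := by simp [ZMod.card]
      rw [h1, Finset.sum_congr rfl fun x _ => hone x, Finset.sum_add_distrib,
        Finset.sum_add_distrib]
      simp [hP, hN, hZ]
    have hcardR : (p : ℝ) = P.card + N.card + Z.card := by exact_mod_cast hcard
    have hZR : (Z.card : ℝ) ≤ 4 := by exact_mod_cast hZb
    have hsqrt1 : (1 : ℝ) ≤ √p := Real.one_le_sqrt.2 hp1
    rw [hsum]
    push_cast
    rw [abs_le]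
    constructor <;> linarith

end Stepanov

section CharacterSums

open Polynomial

variable (p : ℕ) [Fact p.Prime]

/-- The quadratic character modulo `p`, with real values. -/
noncomputable def realQuadChar : MulChar (ZMod p) ℝ :=
  (quadraticChar (ZMod p)).ringHomComp (Int.castRingHom ℝ)

variable {p}

theorem realQuadChar_apply (x : ZMod p) : realQuadChar p x = (quadraticChar (ZMod p) x : ℤ) := rfl

theorem abs_realQuadChar_le_one (x : ZMod p) : |realQuadChar p x| ≤ 1 := by
  rw [realQuadChar_apply]
  rcases quadraticChar_isQuadratic (ZMod p) x with h | h | h <;> simp [h]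

theorem abs_realQuadChar_of_ne_zero {x : ZMod p} (hx : x ≠ 0) : |realQuadChar p x| = 1 := by
  rw [realQuadChar_apply]
  rcases quadraticChar_dichotomy hx with h | h <;> simp [h]

theorem abs_sum_realQuadChar_quartic_le (hp : p ≠ 2) {a b c d : ℕ} (ha : a ∈ Set.Ioo 0 p)
    (hb : b ∈ Set.Ioo 0 p) (hc : c ∈ Set.Ioo 0 p) (hd : d ∈ Set.Ioo 0 p) :
    |∑ x : ZMod p, realQuadChar p (x + a) * realQuadChar p (x + b) * realQuadChar p (x + c)
        * realQuadChar p (x + d)|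
      ≤ 32 * √p + ((if a = b then 1 else 0) * (if c = d then 1 else 0)
        + (if a = c then 1 else 0) * (if b = d then 1 else 0)
        + (if b = c then 1 else 0) * (if a = d then 1 else 0)) * p := by
  by_cases hpair : (a = b ∧ c = d) ∨ (a = c ∧ b = d) ∨ (a = d ∧ b = c)
  · have h1 : |∑ x : ZMod p, realQuadChar p (x + a) * realQuadChar p (x + b)
        * realQuadChar p (x + c) * realQuadChar p (x + d)| ≤ p := by
      refine (Finset.abs_sum_le_sum_abs _ _).trans ?_
      refine (Finset.sum_le_card_nsmul _ _ 1 ?_).trans (by simp [ZMod.card])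
      intro x _
      rw [abs_mul, abs_mul, abs_mul]
      have h := fun y => abs_realQuadChar_le_one (p := p) y
      exact mul_le_one₀ (mul_le_one₀ (mul_le_one₀ (h _) (abs_nonneg _) (h _)) (abs_nonneg _) (h _))
        (abs_nonneg _) (h _)
    refine h1.trans ?_
    have hs : 0 ≤ √(p : ℝ) := Real.sqrt_nonneg _
    have hp0 : (0 : ℝ) ≤ p := by positivity
    rcases hpair with ⟨rfl, rfl⟩ | ⟨rfl, rfl⟩ | ⟨rfl, rfl⟩ <;> simp only [if_true] <;>
      split_ifs <;> nlinarith
  · set f : (ZMod p)[X] := (X + C (a : ZMod p)) * (X + C (b : ZMod p)) * (X + C (c : ZMod p))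
      * (X + C (d : ZMod p)) with hf
    have hne : ∀ y : ZMod p, X + C y ≠ 0 := fun y => X_add_C_ne_zero y
    have hinj : ∀ {u v : ℕ}, u ∈ Set.Ioo 0 p → v ∈ Set.Ioo 0 p →
        ((-u : ZMod p) = -v ↔ u = v) := by
      intro u v hu hv
      rw [neg_inj, ZMod.natCast_eq_natCast_iff', Nat.mod_eq_of_lt hu.2, Nat.mod_eq_of_lt hv.2]
    have hcast : ∀ {u : ℕ}, u ∈ Set.Ioo 0 p → (u : ZMod p) ≠ 0 := by
      intro u hu h
      rw [ZMod.natCast_eq_zero_iff] at h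
      exact absurd (Nat.le_of_dvd hu.1 h) (not_le.2 hu.2)
    have hmult1 : ∀ {u v : ℕ}, u ∈ Set.Ioo 0 p → v ∈ Set.Ioo 0 p →
        (X + C (v : ZMod p)).rootMultiplicity (-u : ZMod p) = if u = v then 1 else 0 := by
      intro u v hu hv
      have : X + C (v : ZMod p) = X - C (-v : ZMod p) := by simp
      rw [this, rootMultiplicity_X_sub_C]
      simp only [hinj hu hv]
    have hmult : ∀ {u : ℕ}, u ∈ Set.Ioo 0 p → f.rootMultiplicity (-u : ZMod p) =
        (if u = a then 1 else 0) + (if u = b then 1 else 0) + (if u = c then 1 else 0)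
          + (if u = d then 1 else 0) := by
      intro u hu
      rw [hf, rootMultiplicity_mul, rootMultiplicity_mul, rootMultiplicity_mul, hmult1 hu ha,
        hmult1 hu hb, hmult1 hu hc, hmult1 hu hd]
      all_goals simp only [ne_eq, mul_eq_zero, hne, or_self, not_false_eq_true]
    obtain ⟨α, hα⟩ : ∃ α, Odd (f.rootMultiplicity α) := by
      by_contra! hcon
      have h1 := hcon (-a)
      have h2 := hcon (-b)
      have h3 := hcon (-c)
      rw [hmult ha] at h1
      rw [hmult hb] at h2
      rw [hmult hc] at h3
      simp only [Nat.not_odd_iff_even, Nat.even_iff] at h1 h2 h3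
      simp only [if_true, eq_comm (a := b) (b := a), eq_comm (a := c) (b := a),
        eq_comm (a := c) (b := b)] at h1 h2 h3
      split_ifs at h1 h2 h3 <;> omega
    have hdeg : f.natDegree ≤ 4 := by rw [hf]; compute_degree
    have h0 : f.eval 0 ≠ 0 := by
      simp [hf, hcast ha, hcast hb, hcast hc, hcast hd]
    have h1 := abs_sum_quadraticChar_eval_le hp hdeg h0 hα
    have h2 : ∑ x : ZMod p, realQuadChar p (x + a) * realQuadChar p (x + b)
        * realQuadChar p (x + c) * realQuadChar p (x + d)
        = ((∑ x : ZMod p, quadraticChar (ZMod p) (f.eval x) : ℤ) : ℝ) := by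
      rw [Int.cast_sum]
      refine Finset.sum_congr rfl fun x _ => ?_
      simp only [hf, realQuadChar_apply, eval_mul, eval_add, eval_X, eval_C, map_mul, Int.cast_mul]
    rw [h2]
    refine h1.trans (le_add_of_nonneg_right ?_)
    positivity

theorem sum_pow_four_sum_realQuadChar_le (hp : p ≠ 2) {B : ℕ} (hB : B < p) :
    ∑ x : ZMod p, (∑ b ∈ Finset.Icc 1 B, realQuadChar p (x + b)) ^ 4
      ≤ 32 * √p * B ^ 4 + 3 * B ^ 2 * p := by
  have hexp : ∀ g : ℕ → ℝ, (∑ b ∈ Finset.Icc 1 B, g b) ^ 4 = ∑ a ∈ Finset.Icc 1 B,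
      ∑ b ∈ Finset.Icc 1 B, ∑ c ∈ Finset.Icc 1 B, ∑ d ∈ Finset.Icc 1 B, g a * g b * g c * g d := by
    intro g
    simp_rw [← Finset.mul_sum, ← Finset.sum_mul, ← Finset.mul_sum, ← Finset.sum_mul,
      ← Finset.mul_sum, ← Finset.sum_mul]
    ring
  have hmem : ∀ a ∈ Finset.Icc 1 B, a ∈ Set.Ioo 0 p := by
    intro a ha
    have := Finset.mem_Icc.1 ha
    exact ⟨by omega, by omega⟩
  have hswap : ∑ x : ZMod p, (∑ b ∈ Finset.Icc 1 B, realQuadChar p (x + b)) ^ 4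
      = ∑ a ∈ Finset.Icc 1 B, ∑ b ∈ Finset.Icc 1 B, ∑ c ∈ Finset.Icc 1 B, ∑ d ∈ Finset.Icc 1 B,
        ∑ x : ZMod p, realQuadChar p (x + a) * realQuadChar p (x + b)
          * realQuadChar p (x + c) * realQuadChar p (x + d) := by
    simp_rw [hexp]
    rw [Finset.sum_comm]
    refine Finset.sum_congr rfl fun a _ => ?_
    rw [Finset.sum_comm]
    refine Finset.sum_congr rfl fun b _ => ?_
    rw [Finset.sum_comm]
    refine Finset.sum_congr rfl fun c _ => ?_
    rw [Finset.sum_comm]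
  rw [hswap]
  calc _ ≤ ∑ a ∈ Finset.Icc 1 B, ∑ b ∈ Finset.Icc 1 B, ∑ c ∈ Finset.Icc 1 B,
        ∑ d ∈ Finset.Icc 1 B, (32 * √p + ((if a = b then 1 else 0) * (if c = d then 1 else 0)
        + (if a = c then 1 else 0) * (if b = d then 1 else 0)
        + (if b = c then 1 else 0) * (if a = d then 1 else 0)) * p) := by
        refine Finset.sum_le_sum fun a ha => Finset.sum_le_sum fun b hb =>
          Finset.sum_le_sum fun c hc => Finset.sum_le_sum fun d hd => ?_
        exact (le_abs_self _).trans (abs_sum_realQuadChar_quartic_le hp (hmem a ha) (hmem b hb)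
          (hmem c hc) (hmem d hd))
    _ = _ := by
        have hone : ∀ x ∈ Finset.Icc 1 B,
            ∑ y ∈ Finset.Icc 1 B, (if x = y then (1 : ℝ) else 0) = 1 := by
          intro x hx
          rw [Finset.sum_ite_eq, if_pos hx]
        have h1 : ∑ a ∈ Finset.Icc 1 B, ∑ b ∈ Finset.Icc 1 B, ∑ c ∈ Finset.Icc 1 B,
            ∑ d ∈ Finset.Icc 1 B, ((if a = b then (1 : ℝ) else 0) * if c = d then 1 else 0)
            = B ^ 2 := by
          simp_rw [← Finset.mul_sum, ← Finset.sum_mul]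
          rw [Finset.sum_congr rfl hone]
          simp [sq]
        have h2 : ∑ a ∈ Finset.Icc 1 B, ∑ b ∈ Finset.Icc 1 B, ∑ c ∈ Finset.Icc 1 B,
            ∑ d ∈ Finset.Icc 1 B, ((if a = c then (1 : ℝ) else 0) * if b = d then 1 else 0)
            = B ^ 2 := by
          simp_rw [← Finset.mul_sum, ← Finset.sum_mul, ← Finset.mul_sum]
          rw [← Finset.sum_mul, Finset.sum_congr rfl hone]
          simp [sq]
        have h3 : ∑ a ∈ Finset.Icc 1 B, ∑ b ∈ Finset.Icc 1 B, ∑ c ∈ Finset.Icc 1 B,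
            ∑ d ∈ Finset.Icc 1 B, ((if b = c then (1 : ℝ) else 0) * if a = d then 1 else 0)
            = B ^ 2 := by
          simp_rw [← Finset.mul_sum, ← Finset.sum_mul, ← Finset.mul_sum]
          rw [Finset.sum_congr rfl hone]
          simp [sq]
        simp only [Finset.sum_add_distrib, ← Finset.sum_mul, h1, h2, h3]
        simp
        ring

open ZMod in
theorem norm_sum_Ioc_stdAddChar_le {t : ZMod p} (ht : t ≠ 0) (M N : ℕ) :
    ‖∑ n ∈ Finset.Ioc M (M + N), stdAddChar (t * (n : ZMod p))‖
      ≤ (p / 2 : ℝ) * (1 / t.val + 1 / (p - t.val : ℝ)) := by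
  set z : ℂ := stdAddChar t with hz
  have hp0 : (0 : ℝ) < p := by exact_mod_cast (Fact.out : p.Prime).pos
  have hv0 : (0 : ℝ) < t.val := by
    exact_mod_cast Nat.pos_of_ne_zero (fun h => ht ((ZMod.val_eq_zero t).1 h))
  have hvp : (t.val : ℝ) < p := by exact_mod_cast ZMod.val_lt t
  have hsum : ∑ n ∈ Finset.Ioc M (M + N), stdAddChar (t * (n : ZMod p))
      = ∑ n ∈ Finset.Ico (M + 1) (M + N + 1), z ^ n := by
    have : Finset.Ioc M (M + N) = Finset.Ico (M + 1) (M + N + 1) := by ext; simp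
    rw [this]
    refine Finset.sum_congr rfl fun n _ => ?_
    rw [hz, ← AddChar.map_nsmul_eq_pow, nsmul_eq_mul, mul_comm]
  have hzn : ‖z‖ = 1 := by simp [hz]
  have hzexp : z = Complex.exp (Complex.I * ((2 * Real.pi * (t.val / p) : ℝ) : ℂ)) := by
    rw [hz]
    conv_lhs => rw [← ZMod.natCast_zmod_val t]
    have := ZMod.stdAddChar_coe (N := p) (t.val : ℤ)
    push_cast at this
    rw [this]
    push_cast
    congr 1
    ring
  have hnorm : ‖z - 1‖ = 2 * |Real.sin (Real.pi * (t.val / p))| := by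
    rw [hzexp, Complex.norm_exp_I_mul_ofReal_sub_one]
    rw [norm_mul]
    simp only [Real.norm_eq_abs, abs_two]
    congr 3
    ring
  set θ : ℝ := t.val / p with hθ
  have hθ0 : 0 < θ := by positivity
  have hθ1 : θ < 1 := by rw [hθ, div_lt_one hp0]; exact hvp
  have hlow : 4 * min θ (1 - θ) ≤ ‖z - 1‖ := by
    rw [hnorm]
    have hpi := Real.pi_pos
    rcases le_total θ (1 / 2) with h | h
    · have h1 := Real.mul_le_sin (x := Real.pi * θ) (by positivity) (by nlinarith)
      have h2 : 2 / Real.pi * (Real.pi * θ) = 2 * θ := by field_simp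
      rw [h2] at h1
      linarith [le_abs_self (Real.sin (Real.pi * θ)), min_le_left θ (1 - θ)]
    · have h1 := Real.mul_le_sin (x := Real.pi * (1 - θ)) (by nlinarith) (by nlinarith)
      have h2 : 2 / Real.pi * (Real.pi * (1 - θ)) = 2 * (1 - θ) := by field_simp
      have h3 : Real.sin (Real.pi * (1 - θ)) = Real.sin (Real.pi * θ) := by
        rw [mul_sub, mul_one, Real.sin_pi_sub]
      rw [h2, h3] at h1
      linarith [le_abs_self (Real.sin (Real.pi * θ)), min_le_right θ (1 - θ)]
  have hmin : 0 < min θ (1 - θ) := lt_min hθ0 (by linarith)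
  have hz1 : z ≠ 1 := by
    intro h
    rw [h, sub_self, norm_zero] at hlow
    linarith
  rw [hsum, geom_sum_Ico hz1 (by omega), norm_div]
  have hnum : ‖z ^ (M + N + 1) - z ^ (M + 1)‖ ≤ 2 := by
    refine (norm_sub_le _ _).trans ?_
    rw [norm_pow, norm_pow, hzn]; norm_num
  calc _ ≤ 2 / (4 * min θ (1 - θ)) := by gcongr
    _ = 1 / 2 * (1 / min θ (1 - θ)) := by field_simp; norm_num
    _ ≤ 1 / 2 * (1 / θ + 1 / (1 - θ)) := by
        gcongr
        rcases min_choice θ (1 - θ) with h | h <;> rw [h]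
        · exact le_add_of_nonneg_right (one_div_nonneg.2 (by linarith))
        · exact le_add_of_nonneg_left (one_div_nonneg.2 (by linarith))
    _ = _ := by
        have : (p : ℝ) - t.val ≠ 0 := by linarith
        have h1 : 1 - θ = (p - t.val) / p := by rw [hθ]; field_simp
        rw [h1, hθ]
        field_simp

end CharacterSums

section CharacterSums

variable {p : ℕ} [Fact p.Prime]

theorem abs_sum_Ioc_realQuadChar_le_sqrt_mul_log (hp : p ≠ 2) (M N : ℕ) :
    |∑ n ∈ Finset.Ioc M (M + N), realQuadChar p (n : ZMod p)| ≤ √p * (1 + Real.log p) := by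
  set χ : MulChar (ZMod p) ℂ := (quadraticChar (ZMod p)).ringHomComp (Int.castRingHom ℂ) with hχ
  set ψ : AddChar (ZMod p) ℂ := ZMod.stdAddChar with hψ
  have hp0 : (0 : ℝ) < p := by exact_mod_cast (Fact.out : p.Prime).pos
  have hring : ringChar (ZMod p) ≠ 2 := by rwa [ZMod.ringChar_zmod_n]
  have hχ1 : χ ≠ 1 := by
    obtain ⟨a, ha⟩ := quadraticChar_exists_neg_one' hring
    intro h
    have h1 := congrArg (fun η => η (a : ZMod p)) h
    simp only [hχ, MulChar.ringHomComp_apply, ha, MulChar.one_apply_coe] at h1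
    norm_num at h1
  have hχq : χ.IsQuadratic := (quadraticChar_isQuadratic (ZMod p)).comp _
  have hχval : ∀ x, χ x = ((realQuadChar p x : ℝ) : ℂ) := by
    intro x; simp [hχ, realQuadChar_apply]
  have hprim : ψ.IsPrimitive := ZMod.isPrimitive_stdAddChar p
  set g := gaussSum χ ψ with hg
  have hgsq : g ^ 2 = χ (-1) * p := by
    rw [hg, gaussSum_sq hχ1 hχq hprim, ZMod.card]
  have hgnorm : ‖g‖ = √p := by
    have h1 : ‖g‖ ^ 2 = p := by
      rw [← norm_pow, hgsq, norm_mul, hχval, Complex.norm_real, Real.norm_eq_abs,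
        abs_realQuadChar_of_ne_zero (neg_ne_zero.2 one_ne_zero)]
      simp
    rw [← h1, Real.sqrt_sq (norm_nonneg _)]
  have htwist : ∀ n : ZMod p, χ n * g = ∑ t : ZMod p, χ t * ψ (t * n) := by
    intro n
    by_cases hn : n = 0
    · subst hn
      rw [MulChar.map_zero, zero_mul]
      simp [MulChar.sum_eq_zero_of_ne_one hχ1]
    · have h1 := gaussSum_mulShift χ ψ (Units.mk0 n hn)
      rw [Units.val_mk0] at h1
      have h2 : χ n * χ n = 1 := by
        rw [hχval]
        have := abs_realQuadChar_of_ne_zero hn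
        rw [← Complex.ofReal_mul, ← abs_mul_abs_self, this]; simp
      rw [hg, ← h1, ← mul_assoc, h2, one_mul, gaussSum]
      simp [AddChar.mulShift_apply, mul_comm]
  have hmain : (∑ n ∈ Finset.Ioc M (M + N), χ (n : ZMod p)) * g
      = ∑ t : ZMod p, χ t * ∑ n ∈ Finset.Ioc M (M + N), ψ (t * n) := by
    rw [Finset.sum_mul]
    simp_rw [htwist, Finset.mul_sum]
    rw [Finset.sum_comm]
  have hbound : ‖∑ t : ZMod p, χ t * ∑ n ∈ Finset.Ioc M (M + N), ψ (t * n)‖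
      ≤ p * (1 + Real.log p) := by
    have hharm : ∑ v ∈ Finset.range (p - 1), (1 / ((v + 1 : ℕ) : ℝ)) ≤ 1 + Real.log p := by
      have h1 := harmonic_le_one_add_log (p - 1)
      rw [harmonic] at h1
      push_cast at h1
      refine le_trans (le_of_eq ?_) (h1.trans ?_)
      · simp
      · gcongr
        · have := (Fact.out : p.Prime).two_le
          have h2 : ((1 : ℕ) : ℝ) ≤ (p - 1 : ℕ) := by exact_mod_cast (by omega : 1 ≤ p - 1)
          push_cast at h2; linarith
        · exact_mod_cast Nat.sub_le p 1
    calc _ ≤ ∑ t ∈ Finset.univ.erase (0 : ZMod p),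
          (p / 2 : ℝ) * (1 / t.val + 1 / (p - t.val : ℝ)) := by
          rw [← Finset.sum_erase (a := (0 : ZMod p)) _ (by rw [MulChar.map_zero, zero_mul])]
          refine norm_sum_le_of_le _ fun t ht => ?_
          have ht0 : t ≠ 0 := (Finset.mem_erase.1 ht).1
          rw [norm_mul, hχval, Complex.norm_real, Real.norm_eq_abs,
            abs_realQuadChar_of_ne_zero ht0, one_mul]
          exact norm_sum_Ioc_stdAddChar_le ht0 M N
      _ = ∑ v ∈ Finset.range (p - 1),
          (p / 2 : ℝ) * (1 / ((v + 1 : ℕ) : ℝ) + 1 / (p - (v + 1 : ℕ) : ℝ)) := by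
          refine Finset.sum_bij' (fun t _ => t.val - 1) (fun v _ => ((v + 1 : ℕ) : ZMod p))
            ?_ ?_ ?_ ?_ ?_
          · intro t ht
            have h1 := ZMod.val_lt t
            have h2 : t.val ≠ 0 := fun h => (Finset.mem_erase.1 ht).1 ((ZMod.val_eq_zero t).1 h)
            simp only [Finset.mem_range]; omega
          · intro v hv
            have hv := Finset.mem_range.1 hv
            rw [Finset.mem_erase]
            refine ⟨fun h => ?_, Finset.mem_univ _⟩
            rw [ZMod.natCast_eq_zero_iff] at h
            have := Nat.le_of_dvd (by omega) h
            omega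
          · intro t ht
            have h2 : t.val ≠ 0 := fun h => (Finset.mem_erase.1 ht).1 ((ZMod.val_eq_zero t).1 h)
            have h3 : t.val - 1 + 1 = t.val := by omega
            simp only [h3, ZMod.natCast_zmod_val]
          · intro v hv
            have hv := Finset.mem_range.1 hv
            rw [ZMod.val_natCast, Nat.mod_eq_of_lt (by omega)]; simp
          · intro t ht
            have h2 : t.val ≠ 0 := fun h => (Finset.mem_erase.1 ht).1 ((ZMod.val_eq_zero t).1 h)
            have h3 : t.val - 1 + 1 = t.val := by omega
            rw [h3]
      _ = p * ∑ v ∈ Finset.range (p - 1), (1 / ((v + 1 : ℕ) : ℝ)) := by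
          have hrefl : ∑ v ∈ Finset.range (p - 1), (1 / (p - (v + 1 : ℕ) : ℝ))
              = ∑ v ∈ Finset.range (p - 1), (1 / ((v + 1 : ℕ) : ℝ)) := by
            rw [← Finset.sum_range_reflect]
            refine Finset.sum_congr rfl fun v hv => ?_
            have hv := Finset.mem_range.1 hv
            have h1 : p - 1 - 1 - v + 1 = p - (v + 1) := by omega
            rw [h1, Nat.cast_sub (by omega)]
            congr 1
            ring
          rw [← Finset.mul_sum, Finset.sum_add_distrib, hrefl]
          ring
      _ ≤ _ := by gcongr
  rw [← hmain, norm_mul, hgnorm] at hbound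
  have hcast : ∑ n ∈ Finset.Ioc M (M + N), χ (n : ZMod p)
      = ((∑ n ∈ Finset.Ioc M (M + N), realQuadChar p (n : ZMod p) : ℝ) : ℂ) := by
    rw [Complex.ofReal_sum]
    exact Finset.sum_congr rfl fun n _ => hχval _
  rw [hcast, Complex.norm_real, Real.norm_eq_abs] at hbound
  have hsq : (p : ℝ) = √p * √p := (Real.mul_self_sqrt hp0.le).symm
  have hsp : 0 < √(p : ℝ) := Real.sqrt_pos.2 hp0
  have h3 : √p * |∑ n ∈ Finset.Ioc M (M + N), realQuadChar p (n : ZMod p)|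
      ≤ √p * (√p * (1 + Real.log p)) := by
    rw [← mul_assoc (√(p : ℝ)), ← hsq, mul_comm (√(p : ℝ))]
    exact hbound
  exact le_of_mul_le_mul_left h3 hsp

end CharacterSums

section Counting

theorem sum_comp_pow_four_le {ι κ : Type*} [Fintype κ] [DecidableEq κ] (I : Finset ι) (φ : ι → κ)
    (G : κ → ℝ) :
    (∑ i ∈ I, G (φ i)) ^ 4 ≤ (I.card : ℝ) ^ 2 *
      (∑ i ∈ I, ∑ j ∈ I, if φ i = φ j then (1 : ℝ) else 0) * ∑ u, G u ^ 4 := by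
  set ν : κ → ℝ := fun u => ∑ i ∈ I, if φ i = u then (1 : ℝ) else 0 with hν
  have h1 : (∑ i ∈ I, G (φ i)) ^ 2 ≤ (I.card : ℝ) * ∑ i ∈ I, G (φ i) ^ 2 :=
    sq_sum_le_card_mul_sum_sq
  have h2 : ∑ i ∈ I, G (φ i) ^ 2 = ∑ u, ν u * G u ^ 2 := by
    simp_rw [hν, Finset.sum_mul]
    rw [Finset.sum_comm]
    simp
  have h3 : (∑ u, ν u * G u ^ 2) ^ 2 ≤ (∑ u, ν u ^ 2) * ∑ u, (G u ^ 2) ^ 2 :=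
    Finset.sum_mul_sq_le_sq_mul_sq _ _ _
  have h4 : ∑ u, ν u ^ 2 = ∑ i ∈ I, ∑ j ∈ I, if φ i = φ j then (1 : ℝ) else 0 := by
    simp_rw [hν, sq, Finset.sum_mul_sum]
    rw [Finset.sum_comm]
    refine Finset.sum_congr rfl fun i _ => ?_
    rw [Finset.sum_comm]
    refine Finset.sum_congr rfl fun j _ => ?_
    simp [eq_comm]
  have h5 : ∑ u, (G u ^ 2) ^ 2 = ∑ u, G u ^ 4 := by simp_rw [← pow_mul]
  rw [h4, h5] at h3
  rw [h2] at h1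
  calc (∑ i ∈ I, G (φ i)) ^ 4 = ((∑ i ∈ I, G (φ i)) ^ 2) ^ 2 := by ring
    _ ≤ ((I.card : ℝ) * ∑ u, ν u * G u ^ 2) ^ 2 := by gcongr
    _ = (I.card : ℝ) ^ 2 * (∑ u, ν u * G u ^ 2) ^ 2 := by ring
    _ ≤ (I.card : ℝ) ^ 2 * ((∑ i ∈ I, ∑ j ∈ I, if φ i = φ j then (1 : ℝ) else 0)
        * ∑ u, G u ^ 4) := by gcongr
    _ = _ := by ring

theorem card_Ioc_filter_modEq_le (M N r v : ℕ) (hr : 0 < r) :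
    (((Finset.Ioc M (M + N)).filter fun n => n ≡ v [MOD r]).card : ℝ) ≤ N / r + 1 := by
  have h := Nat.Ioc_filter_modEq_card M (M + N) hr v
  have hr' : (0 : ℝ) < r := by exact_mod_cast hr
  have h2 : ((((Finset.Ioc M (M + N)).filter fun n => n ≡ v [MOD r]).card : ℤ) : ℝ) ≤ N / r + 1 := by
    rw [h]
    push_cast
    rw [max_le_iff]
    constructor
    · have h3 := Int.floor_le ((((M + N : ℕ) : ℚ) - v) / r)
      have h4 := Int.lt_floor_add_one (((M : ℚ) - v) / r)
      have h5 : (((M + N : ℕ) : ℚ) - v) / r - ((M : ℚ) - v) / r = N / r := by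
        push_cast; ring
      have h6 : ((⌊(((M + N : ℕ) : ℚ) - v) / r⌋ : ℚ) - ⌊((M : ℚ) - v) / r⌋) ≤ N / r + 1 := by
        linarith
      have h7 := (Rat.cast_le (K := ℝ)).2 h6
      push_cast at h7 ⊢
      exact h7
    · positivity
  exact_mod_cast h2

theorem sum_gcd_div_le (A : ℕ) :
    ∑ a ∈ Finset.Icc 1 A, ∑ b ∈ Finset.Icc 1 A, (Nat.gcd a b : ℝ) / a
      ≤ A * (∑ k ∈ Finset.Icc 1 A, (1 / k : ℝ)) ^ 2 := by
  set H := ∑ k ∈ Finset.Icc 1 A, (1 / k : ℝ) with hH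
  have hgcd : ∀ a ∈ Finset.Icc 1 A, ∀ b ∈ Finset.Icc 1 A, (Nat.gcd a b : ℝ) / a ≤
      ∑ g ∈ Finset.Icc 1 A, (if g ∣ a then (g : ℝ) / a else 0) * (if g ∣ b then 1 else 0) := by
    intro a ha b hb
    have ha := Finset.mem_Icc.1 ha
    have hmem : Nat.gcd a b ∈ Finset.Icc 1 A := by
      rw [Finset.mem_Icc]
      exact ⟨Nat.gcd_pos_of_pos_left _ (by omega),
        (Nat.le_of_dvd (by omega) (Nat.gcd_dvd_left a b)).trans ha.2⟩
    refine le_trans (le_of_eq ?_) (Finset.single_le_sum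
      (f := fun g => (if g ∣ a then (g : ℝ) / a else 0) * (if g ∣ b then 1 else 0)) ?_ hmem)
    · simp [Nat.gcd_dvd_left, Nat.gcd_dvd_right]
    · intro g _; positivity
  have hmult : ∀ g ∈ Finset.Icc 1 A, ∑ b ∈ Finset.Icc 1 A, (if g ∣ b then (1 : ℝ) else 0)
      ≤ A / g := by
    intro g hg
    rw [Finset.sum_boole]
    have h1 : (Finset.Icc 1 A).filter (g ∣ ·) = (Finset.Ioc 0 A).filter (g ∣ ·) := by
      ext; simp [Nat.succ_le_iff]
    rw [h1, Nat.Ioc_filter_dvd_card_eq_div]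
    exact Nat.cast_div_le
  have hinv : ∀ g ∈ Finset.Icc 1 A, ∑ a ∈ Finset.Icc 1 A, (if g ∣ a then (g : ℝ) / a else 0)
      ≤ H := by
    intro g hg
    have hg := Finset.mem_Icc.1 hg
    have hg0 : (g : ℝ) ≠ 0 := by exact_mod_cast (by omega : g ≠ 0)
    rw [← Finset.sum_filter]
    have hsub : (Finset.Icc 1 A).filter (g ∣ ·) ⊆ (Finset.Icc 1 A).image (g * ·) := by
      intro a ha
      obtain ⟨h1, k, rfl⟩ := Finset.mem_filter.1 ha
      have h1 := Finset.mem_Icc.1 h1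
      refine Finset.mem_image.2 ⟨k, Finset.mem_Icc.2 ⟨?_, ?_⟩, rfl⟩
      · exact Nat.pos_of_mul_pos_left h1.1
      · exact (Nat.le_mul_of_pos_left k (by omega)).trans h1.2
    refine (Finset.sum_le_sum_of_subset_of_nonneg hsub fun _ _ _ => by positivity).trans ?_
    rw [Finset.sum_image fun x _ y _ h => Nat.eq_of_mul_eq_mul_left (by omega) h]
    refine le_of_eq (Finset.sum_congr rfl fun k hk => ?_)
    push_cast
    rw [div_mul_eq_div_div, div_self hg0]
  calc _ ≤ ∑ a ∈ Finset.Icc 1 A, ∑ b ∈ Finset.Icc 1 A, ∑ g ∈ Finset.Icc 1 A,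
        (if g ∣ a then (g : ℝ) / a else 0) * (if g ∣ b then 1 else 0) :=
        Finset.sum_le_sum fun a ha => Finset.sum_le_sum fun b hb => hgcd a ha b hb
    _ = ∑ g ∈ Finset.Icc 1 A, (∑ a ∈ Finset.Icc 1 A, (if g ∣ a then (g : ℝ) / a else 0))
        * ∑ b ∈ Finset.Icc 1 A, (if g ∣ b then (1 : ℝ) else 0) := by
        simp_rw [Finset.sum_mul_sum]
        rw [Finset.sum_congr rfl (fun a _ => Finset.sum_comm), Finset.sum_comm]
    _ ≤ ∑ g ∈ Finset.Icc 1 A, H * (A / g) := by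
        refine Finset.sum_le_sum fun g hg => mul_le_mul (hinv g hg) (hmult g hg) ?_ ?_
        · exact Finset.sum_nonneg fun _ _ => by positivity
        · exact Finset.sum_nonneg fun _ _ => by positivity
    _ = _ := by
        rw [← Finset.mul_sum]
        have : ∑ g ∈ Finset.Icc 1 A, (A / g : ℝ) = A * H := by
          rw [hH, Finset.mul_sum]
          exact Finset.sum_congr rfl fun _ _ => by ring
        rw [this]; ring

theorem card_mul_eq_mul_le {p : ℕ} [Fact p.Prime] {A N : ℕ} (hAN : 2 * A * N < p) (M : ℕ)
    {a b : ℕ} (ha : a ∈ Finset.Icc 1 A) (hb : b ∈ Finset.Icc 1 A) :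
    ((((Finset.Ioc M (M + N)) ×ˢ (Finset.Ioc M (M + N))).filter fun m : ℕ × ℕ =>
      (m.1 : ZMod p) * b = m.2 * a).card : ℝ) ≤ N * (Nat.gcd a b / a) + 1 := by
  have ha := Finset.mem_Icc.1 ha
  have hb := Finset.mem_Icc.1 hb
  set T := ((Finset.Ioc M (M + N)) ×ˢ (Finset.Ioc M (M + N))).filter fun m : ℕ × ℕ =>
      (m.1 : ZMod p) * b = m.2 * a with hT
  have hdiff : ∀ m ∈ T, ∀ n ∈ T,
      ((m.1 : ℤ) - n.1) * b = ((m.2 : ℤ) - n.2) * a := by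
    intro m hm n hn
    obtain ⟨hm1, hm2⟩ := Finset.mem_filter.1 hm
    obtain ⟨hn1, hn2⟩ := Finset.mem_filter.1 hn
    simp only [Finset.mem_product, Finset.mem_Ioc] at hm1 hn1
    have hdvd : (p : ℤ) ∣ ((m.1 : ℤ) - n.1) * b - ((m.2 : ℤ) - n.2) * a := by
      rw [← ZMod.intCast_zmod_eq_zero_iff_dvd _ p]
      push_cast
      linear_combination hm2 - hn2
    have habs : |((m.1 : ℤ) - n.1) * b - ((m.2 : ℤ) - n.2) * a| < p := by
      have h1 : |((m.1 : ℤ) - n.1) * b| ≤ N * A := by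
        rw [abs_mul]
        refine mul_le_mul ?_ ?_ (abs_nonneg _) (by positivity)
        · rw [abs_le]; constructor <;> omega
        · rw [abs_le]; constructor <;> omega
      have h2 : |((m.2 : ℤ) - n.2) * a| ≤ N * A := by
        rw [abs_mul]
        refine mul_le_mul ?_ ?_ (abs_nonneg _) (by positivity)
        · rw [abs_le]; constructor <;> omega
        · rw [abs_le]; constructor <;> omega
      have h3 : (2 : ℤ) * A * N < p := by exact_mod_cast hAN
      calc _ ≤ _ := abs_sub _ _
        _ ≤ (N : ℤ) * A + N * A := add_le_add h1 h2
        _ < p := by linarith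
    have := Int.eq_zero_of_abs_lt_dvd hdvd habs
    linarith
  rcases T.eq_empty_or_nonempty with hE | ⟨n, hn⟩
  · rw [hE]; simp; positivity
  · set g := Nat.gcd a b with hg
    have hg0 : 0 < g := Nat.gcd_pos_of_pos_left _ (by omega)
    have hr : 0 < a / g := Nat.div_pos (Nat.le_of_dvd (by omega) (Nat.gcd_dvd_left a b)) hg0
    have hcard : T.card ≤ ((Finset.Ioc M (M + N)).filter fun m => m ≡ n.1 [MOD (a / g)]).card := by
      refine Finset.card_le_card_of_injOn Prod.fst ?_ ?_
      · intro m hm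
        have hm' := (Finset.mem_filter.1 (Finset.mem_coe.1 hm)).1
        refine Finset.mem_coe.2 (Finset.mem_filter.2 ⟨(Finset.mem_product.1 hm').1, ?_⟩)
        have h1 := hdiff n hn m hm
        rw [Nat.modEq_iff_dvd]
        have hcop : IsCoprime ((a / g : ℕ) : ℤ) ((b / g : ℕ) : ℤ) :=
          Nat.isCoprime_iff_coprime.2 (Nat.coprime_div_gcd_div_gcd hg0)
        have haz : (a : ℤ) = (a / g : ℕ) * g := by
          exact_mod_cast (Nat.div_mul_cancel (Nat.gcd_dvd_left a b)).symm
        have hbz : (b : ℤ) = (b / g : ℕ) * g := by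
          exact_mod_cast (Nat.div_mul_cancel (Nat.gcd_dvd_right a b)).symm
        refine hcop.dvd_of_dvd_mul_right ⟨(n.2 : ℤ) - m.2, ?_⟩
        have hgz : (g : ℤ) ≠ 0 := by exact_mod_cast hg0.ne'
        apply mul_right_cancel₀ hgz
        rw [haz, hbz] at h1
        linear_combination h1
      · intro m hm m' hm' h
        have h1 := hdiff m hm m' hm'
        have ha0 : (a : ℤ) ≠ 0 := by exact_mod_cast (by omega : a ≠ 0)
        rw [h, sub_self, zero_mul] at h1
        have h2 := (mul_eq_zero.1 h1.symm).resolve_right ha0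
        exact Prod.ext h (by omega)
    have hcardR : (T.card : ℝ) ≤ N / (a / g : ℕ) + 1 :=
      le_trans (by exact_mod_cast hcard) (card_Ioc_filter_modEq_le M N (a / g) n.1 hr)
    have hgR : (g : ℝ) ≠ 0 := by exact_mod_cast hg0.ne'
    have haR : (a : ℝ) ≠ 0 := by exact_mod_cast (by omega : a ≠ 0)
    rw [Nat.cast_div (Nat.gcd_dvd_left a b) hgR] at hcardR
    refine hcardR.trans (le_of_eq ?_)
    rw [← hg]
    field_simp

end Counting

section Burgess

theorem sum_inv_Icc_le_one_add_log {p A : ℕ} (hA : A ≤ p) :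
    ∑ k ∈ Finset.Icc 1 A, (1 / k : ℝ) ≤ 1 + Real.log p := by
  have h := harmonic_le_one_add_log A
  rw [harmonic_eq_sum_Icc] at h
  push_cast at h
  simp_rw [one_div]
  refine h.trans ?_
  rcases Nat.eq_zero_or_pos A with rfl | hA0
  · have : 0 ≤ Real.log (p : ℝ) := Real.log_natCast_nonneg p
    simpa using this
  · have : (0 : ℝ) < A := by exact_mod_cast hA0
    gcongr

variable {p : ℕ} [Fact p.Prime]

theorem sum_sum_ite_mul_inv_eq_le {A N : ℕ} (hA : A < p) (hAN : 2 * A * N < p) (hle : A ≤ N)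
    (M : ℕ) :
    ∑ i ∈ Finset.Icc 1 A ×ˢ Finset.Ioc M (M + N), ∑ j ∈ Finset.Icc 1 A ×ˢ Finset.Ioc M (M + N),
      (if (i.2 : ZMod p) * (i.1 : ZMod p)⁻¹ = j.2 * (j.1 : ZMod p)⁻¹ then (1 : ℝ) else 0)
      ≤ 2 * A * N * (1 + Real.log p) ^ 2 := by
  set H := 1 + Real.log (p : ℝ) with hH
  have hH1 : 1 ≤ H := by
    have : 0 ≤ Real.log (p : ℝ) := Real.log_natCast_nonneg p
    linarith
  have hne : ∀ a ∈ Finset.Icc 1 A, (a : ZMod p) ≠ 0 := by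
    intro a ha h
    have ha := Finset.mem_Icc.1 ha
    rw [ZMod.natCast_eq_zero_iff] at h
    exact absurd (Nat.le_of_dvd (by omega) h) (by omega)
  have h1 : ∀ a ∈ Finset.Icc 1 A, ∀ b ∈ Finset.Icc 1 A,
      ∑ n ∈ Finset.Ioc M (M + N), ∑ m ∈ Finset.Ioc M (M + N),
        (if (n : ZMod p) * (a : ZMod p)⁻¹ = m * (b : ZMod p)⁻¹ then (1 : ℝ) else 0)
      ≤ N * (Nat.gcd a b / a) + 1 := by
    intro a ha b hb
    refine le_trans (le_of_eq ?_) (card_mul_eq_mul_le hAN M ha hb)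
    rw [← Finset.sum_boole, Finset.sum_product]
    refine Finset.sum_congr rfl fun n _ => Finset.sum_congr rfl fun m _ => ?_
    have hiff : (n : ZMod p) * (a : ZMod p)⁻¹ = m * (b : ZMod p)⁻¹ ↔
        (n : ZMod p) * b = m * a := by
      rw [← div_eq_mul_inv, ← div_eq_mul_inv, div_eq_div_iff (hne a ha) (hne b hb)]
    simp only [hiff]
  have hsum := sum_gcd_div_le A
  have hAH := sum_inv_Icc_le_one_add_log hA.le
  have hA2 : (A : ℝ) ≤ N := by exact_mod_cast hle
  have hsq : (∑ k ∈ Finset.Icc 1 A, (1 / k : ℝ)) ^ 2 ≤ H ^ 2 := by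
    have : 0 ≤ ∑ k ∈ Finset.Icc 1 A, (1 / k : ℝ) := Finset.sum_nonneg fun _ _ => by positivity
    gcongr
  calc _ = ∑ a ∈ Finset.Icc 1 A, ∑ b ∈ Finset.Icc 1 A,
      ∑ n ∈ Finset.Ioc M (M + N), ∑ m ∈ Finset.Ioc M (M + N),
        (if (n : ZMod p) * (a : ZMod p)⁻¹ = m * (b : ZMod p)⁻¹ then (1 : ℝ) else 0) := by
        simp_rw [Finset.sum_product]
        exact Finset.sum_congr rfl fun a _ => Finset.sum_comm
    _ ≤ ∑ a ∈ Finset.Icc 1 A, ∑ b ∈ Finset.Icc 1 A, (N * ((Nat.gcd a b : ℝ) / a) + 1) :=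
        Finset.sum_le_sum fun a ha => Finset.sum_le_sum fun b hb => h1 a ha b hb
    _ = N * (∑ a ∈ Finset.Icc 1 A, ∑ b ∈ Finset.Icc 1 A, ((Nat.gcd a b : ℝ) / a)) + A * A := by
        simp [Finset.sum_add_distrib, Finset.mul_sum]
    _ ≤ N * (A * H ^ 2) + A * A := by
        gcongr
        exact hsum.trans (by gcongr)
    _ ≤ N * (A * H ^ 2) + N * (A * H ^ 2) := by
        have : (1 : ℝ) ≤ H ^ 2 := one_le_pow₀ hH1
        have : (A : ℝ) * A * 1 ≤ A * N * H ^ 2 := by gcongr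
        linarith
    _ = _ := by ring

theorem sum_realQuadChar_add_mul_pow_four_le (hp : p ≠ 2) {A B N : ℕ} (hA : A < p)
    (hB : B < p) (hAN : 2 * A * N < p) (hle : A ≤ N) (M : ℕ) :
    (∑ a ∈ Finset.Icc 1 A, ∑ b ∈ Finset.Icc 1 B,
      ∑ n ∈ Finset.Ioc M (M + N), realQuadChar p ((n + a * b : ℕ) : ZMod p)) ^ 4
      ≤ (A * N : ℝ) ^ 2 * (2 * A * N * (1 + Real.log p) ^ 2)
        * (32 * √p * B ^ 4 + 3 * B ^ 2 * p) := by
  set I := Finset.Icc 1 A ×ˢ Finset.Ioc M (M + N) with hI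
  set φ : ℕ × ℕ → ZMod p := fun i => (i.2 : ZMod p) * (i.1 : ZMod p)⁻¹ with hφ
  set G : ZMod p → ℝ := fun u => |∑ b ∈ Finset.Icc 1 B, realQuadChar p (u + b)| with hG
  have h1 : |∑ a ∈ Finset.Icc 1 A, ∑ b ∈ Finset.Icc 1 B,
      ∑ n ∈ Finset.Ioc M (M + N), realQuadChar p ((n + a * b : ℕ) : ZMod p)|
      ≤ ∑ i ∈ I, G (φ i) := by
    rw [hI, Finset.sum_product]
    refine (Finset.abs_sum_le_sum_abs _ _).trans (Finset.sum_le_sum fun a ha => ?_)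
    have ha := Finset.mem_Icc.1 ha
    have ha0 : (a : ZMod p) ≠ 0 := by
      rw [Ne, ZMod.natCast_eq_zero_iff]
      exact fun h => absurd (Nat.le_of_dvd (by omega) h) (by omega)
    rw [Finset.sum_comm]
    refine (Finset.abs_sum_le_sum_abs _ _).trans (Finset.sum_le_sum fun n hn => ?_)
    have h2 : ∀ b ∈ Finset.Icc 1 B, realQuadChar p ((n + a * b : ℕ) : ZMod p)
        = realQuadChar p (a : ZMod p) * realQuadChar p (φ (a, n) + b) := by
      intro b _
      rw [← map_mul]
      congr 1
      simp only [hφ]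
      push_cast
      field_simp
    rw [Finset.sum_congr rfl h2, ← Finset.mul_sum, abs_mul, abs_realQuadChar_of_ne_zero ha0, one_mul]
  have h3 : ∑ u, G u ^ 4 ≤ 32 * √p * B ^ 4 + 3 * B ^ 2 * p := by
    simp only [hG, Even.pow_abs (by decide : Even 4)]
    exact sum_pow_four_sum_realQuadChar_le hp hB
  have h4 := sum_sum_ite_mul_inv_eq_le hA hAN hle M
  have h5 := sum_comp_pow_four_le I φ G
  have hcard : (I.card : ℝ) = A * N := by simp [hI]
  rw [hcard] at h5
  calc _ = |∑ a ∈ Finset.Icc 1 A, ∑ b ∈ Finset.Icc 1 B,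
      ∑ n ∈ Finset.Ioc M (M + N), realQuadChar p ((n + a * b : ℕ) : ZMod p)| ^ 4 := by
        rw [Even.pow_abs (by decide : Even 4)]
    _ ≤ (∑ i ∈ I, G (φ i)) ^ 4 := by gcongr
    _ ≤ _ := h5
    _ ≤ _ := by
        have : 0 ≤ Real.log (p : ℝ) := Real.log_natCast_nonneg p
        have h6 : 0 ≤ ∑ u, G u ^ 4 := Finset.sum_nonneg fun u _ => by simp only [hG]; positivity
        gcongr

/-- Comparison of a character sum over an interval with its average over shifts by products. -/
theorem mul_abs_sum_Ioc_le_of_shift (f : ℕ → ℝ) {A B M N : ℕ} {E : ℝ}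
    (hE : ∀ M' h, h ≤ A * B → |∑ n ∈ Finset.Ioc M' (M' + h), f n| ≤ E) :
    (A * B : ℝ) * |∑ n ∈ Finset.Ioc M (M + N), f n| ≤
      |∑ a ∈ Finset.Icc 1 A, ∑ b ∈ Finset.Icc 1 B, ∑ n ∈ Finset.Ioc M (M + N), f (n + a * b)|
      + A * B * (2 * E) := by
  have h1 : ∀ h ≤ A * B, |∑ n ∈ Finset.Ioc M (M + N), f n
      - ∑ n ∈ Finset.Ioc M (M + N), f (n + h)| ≤ 2 * E := by
    intro h hh
    have e1 : ∑ n ∈ Finset.Ioc M (M + N), f (n + h) = ∑ n ∈ Finset.Ioc (M + h) (M + N + h), f n := by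
      rw [← Finset.map_add_right_Ioc, Finset.sum_map]; rfl
    have e2 := Finset.sum_Ioc_consecutive f (Nat.le_add_right M N) (Nat.le_add_right (M + N) h)
    have e3 := Finset.sum_Ioc_consecutive f (Nat.le_add_right M h)
      (by omega : M + h ≤ M + N + h)
    have e4 := hE M h hh
    have e5 := hE (M + N) h hh
    rw [e1]
    rw [abs_le] at *
    constructor <;> linarith [e4.1, e4.2, e5.1, e5.2]
  have h2 : (A * B : ℝ) * ∑ n ∈ Finset.Ioc M (M + N), f n =
      (∑ a ∈ Finset.Icc 1 A, ∑ b ∈ Finset.Icc 1 B, ∑ n ∈ Finset.Ioc M (M + N), f (n + a * b))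
      + ∑ a ∈ Finset.Icc 1 A, ∑ b ∈ Finset.Icc 1 B, (∑ n ∈ Finset.Ioc M (M + N), f n
      - ∑ n ∈ Finset.Ioc M (M + N), f (n + a * b)) := by
    simp only [Finset.sum_sub_distrib, Finset.sum_const, Nat.card_Icc, nsmul_eq_mul]
    simp
    ring
  have h3 : |∑ a ∈ Finset.Icc 1 A, ∑ b ∈ Finset.Icc 1 B, (∑ n ∈ Finset.Ioc M (M + N), f n
      - ∑ n ∈ Finset.Ioc M (M + N), f (n + a * b))| ≤ A * B * (2 * E) := by
    calc _ ≤ ∑ a ∈ Finset.Icc 1 A, ∑ b ∈ Finset.Icc 1 B, (2 * E) := by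
          refine (Finset.abs_sum_le_sum_abs _ _).trans (Finset.sum_le_sum fun a ha => ?_)
          refine (Finset.abs_sum_le_sum_abs _ _).trans (Finset.sum_le_sum fun b hb => ?_)
          exact h1 _ (Nat.mul_le_mul (Finset.mem_Icc.1 ha).2 (Finset.mem_Icc.1 hb).2)
      _ = _ := by simp; ring
  have h4 : (A * B : ℝ) * |∑ n ∈ Finset.Ioc M (M + N), f n|
      = |(A * B : ℝ) * ∑ n ∈ Finset.Ioc M (M + N), f n| := by
    rw [abs_mul, abs_of_nonneg (by positivity : (0 : ℝ) ≤ A * B)]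
  rw [h4, h2]
  exact (abs_add_le _ _).trans (by gcongr)

variable {p : ℕ} [Fact p.Prime]

/-- The Burgess bound, with exponent `3 / 16`, for the quadratic character. -/
theorem abs_sum_Ioc_realQuadChar_le (hp : p ≠ 2) (M N : ℕ) :
    |∑ n ∈ Finset.Ioc M (M + N), realQuadChar p (n : ZMod p)|
      ≤ 32 * (1 + Real.log p) * (p : ℝ) ^ (3 / 16 : ℝ) * √N := by
  have hp1 : (1 : ℝ) ≤ p := by exact_mod_cast (Fact.out : p.Prime).one_lt.le
  set q : ℝ := (p : ℝ) ^ (1 / 16 : ℝ) with hq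
  have hq1 : 1 ≤ q := Real.one_le_rpow hp1 (by norm_num)
  have hq16 : (p : ℝ) = q ^ 16 := by
    rw [hq, ← Real.rpow_natCast, ← Real.rpow_mul (by positivity)]; norm_num
  have hq3 : (p : ℝ) ^ (3 / 16 : ℝ) = q ^ 3 := by
    rw [hq, ← Real.rpow_natCast, ← Real.rpow_mul (by positivity)]; norm_num
  have hq8 : √(p : ℝ) = q ^ 8 := by
    rw [hq16, show q ^ 16 = (q ^ 8) ^ 2 by ring, Real.sqrt_sq (by positivity)]
  rw [hq3]
  set H : ℝ := 1 + Real.log p with hH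
  have hH1 : 1 ≤ H := by
    have : 0 ≤ Real.log (p : ℝ) := Real.log_natCast_nonneg p
    linarith
  have hq0 : 0 < q := by linarith
  set K : ℝ := 32 * H * q ^ 3 with hK
  have hK0 : 0 ≤ K := by positivity
  induction N using Nat.strong_induction_on generalizing M with
  | _ N ih =>
  rcases le_or_gt (N : ℝ) (1024 * q ^ 6) with hs | hs
  · have h1 : |∑ n ∈ Finset.Ioc M (M + N), realQuadChar p (n : ZMod p)| ≤ N := by
      refine (Finset.abs_sum_le_sum_abs _ _).trans ?_
      refine (Finset.sum_le_sum fun n _ => abs_realQuadChar_le_one _).trans ?_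
      simp
    have h2 : √(N : ℝ) ≤ 32 * q ^ 3 := by
      rw [Real.sqrt_le_left (by positivity)]
      linarith
    calc _ ≤ (N : ℝ) := h1
      _ = √N * √N := (Real.mul_self_sqrt (by positivity)).symm
      _ ≤ (32 * q ^ 3) * √N := by gcongr
      _ ≤ K * √N := by
        gcongr
        rw [hK]
        nlinarith [pow_pos hq0 3]
  rcases le_or_gt (q ^ 10) (N : ℝ) with hl | hl
  · have h2 : q ^ 5 ≤ √(N : ℝ) := by
      refine Real.le_sqrt_of_sq_le ?_
      linarith
    calc _ ≤ √(p : ℝ) * H := abs_sum_Ioc_realQuadChar_le_sqrt_mul_log hp M N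
      _ = H * q ^ 3 * q ^ 5 := by rw [hq8]; ring
      _ ≤ H * q ^ 3 * √N := by gcongr
      _ ≤ K * √N := by
        rw [hK]; gcongr; linarith
  have hq4 : 1024 < q ^ 4 := by
    have : 1024 * q ^ 6 < q ^ 4 * q ^ 6 := by linarith
    exact lt_of_mul_lt_mul_right this (by positivity)
  set B : ℕ := ⌊q ^ 4⌋₊ with hB
  have hB1 : (B : ℝ) ≤ q ^ 4 := Nat.floor_le (by positivity)
  have hB2 : q ^ 4 ≤ 2 * B := by
    have := Nat.lt_floor_add_one (q ^ 4)
    rw [← hB] at this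
    linarith
  have hB0 : (0 : ℝ) < B := by linarith
  have hB0' : 0 < B := by exact_mod_cast hB0
  have hNB : (16 * B : ℝ) ≤ N := by
    have : q ^ 4 ≤ q ^ 6 := pow_le_pow_right₀ hq1 (by norm_num)
    linarith
  have hNB' : 16 * B ≤ N := by exact_mod_cast hNB
  set A : ℕ := N / (16 * B) with hA
  have hA0 : 0 < A := Nat.div_pos hNB' (by omega)
  have hA1 : 16 * B * A ≤ N := Nat.mul_div_le N (16 * B)
  have hA2 : N ≤ 32 * A * B := by
    have h1 : N < 16 * B * (A + 1) := by
      rw [mul_comm]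
      exact (Nat.div_lt_iff_lt_mul (by omega)).1 (Nat.lt_succ_self A)
    nlinarith
  have hA1' : (16 * B * A : ℝ) ≤ N := by exact_mod_cast hA1
  have hA2' : (N : ℝ) ≤ 32 * A * B := by exact_mod_cast hA2
  have hA0' : (1 : ℝ) ≤ A := by exact_mod_cast hA0
  have hle : A ≤ N := by nlinarith
  have hN0 : (0 : ℝ) < N := by linarith
  have hqp : q ^ 10 ≤ p := by
    rw [hq16]; exact pow_le_pow_right₀ hq1 (by norm_num)
  have hNp : N < p := by
    have : (N : ℝ) < p := by linarith
    exact_mod_cast this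
  have hAp : A < p := by omega
  have hBp : B < p := by omega
  have hAN : 2 * A * N < p := by
    have h1 : (2 * A * N : ℝ) * q ^ 4 < p * q ^ 4 := by
      calc (2 * A * N : ℝ) * q ^ 4 ≤ (2 * A * N) * (2 * B) := by gcongr
        _ = (4 * B * A) * N := by ring
        _ ≤ N * N := by
          gcongr
          nlinarith [mul_pos hB0 (lt_of_lt_of_le one_pos hA0')]
        _ < q ^ 10 * q ^ 10 := by gcongr
        _ = p * q ^ 4 := by rw [hq16]; ring
    have := lt_of_mul_lt_mul_right h1 (by positivity)
    exact_mod_cast this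
  have hE : ∀ M' h, h ≤ A * B →
      |∑ n ∈ Finset.Ioc M' (M' + h), realQuadChar p (n : ZMod p)| ≤ K * √N / 4 := by
    intro M' h hh
    have hhN : 16 * h ≤ N := by nlinarith
    refine (ih h (by omega) M').trans ?_
    have h1 : √(h : ℝ) ≤ √N / 4 := by
      rw [Real.sqrt_le_left (by positivity), div_pow, Real.sq_sqrt hN0.le, le_div_iff₀ (by norm_num)]
      have : (16 * h : ℝ) ≤ N := by exact_mod_cast hhN
      linarith
    calc K * √h ≤ K * (√N / 4) := by gcongr
      _ = _ := by ring
  have hshift := mul_abs_sum_Ioc_le_of_shift (fun n => realQuadChar p (n : ZMod p))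
    (A := A) (B := B) (M := M) (N := N) hE
  set D := ∑ a ∈ Finset.Icc 1 A, ∑ b ∈ Finset.Icc 1 B, ∑ n ∈ Finset.Ioc M (M + N),
    realQuadChar p ((n + a * b : ℕ) : ZMod p) with hD
  have hD4 : D ^ 4 ≤ _ := sum_realQuadChar_add_mul_pow_four_le hp hAp hBp hAN hle M
  rw [← hH, hq8, hq16] at hD4
  have hB4 : 3 * (B : ℝ) ^ 2 * q ^ 16 ≤ 12 * (q ^ 8 * B ^ 4) := by
    calc 3 * (B : ℝ) ^ 2 * q ^ 16 = 3 * B ^ 2 * q ^ 8 * (q ^ 4) ^ 2 := by ring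
      _ ≤ 3 * B ^ 2 * q ^ 8 * (2 * B) ^ 2 := by gcongr
      _ = _ := by ring
  have hfin : |D| ≤ A * B * (K * √N / 2) := by
    refine le_of_pow_le_pow_left₀ (n := 4) (by norm_num) (by positivity) ?_
    rw [Even.pow_abs (by decide : Even 4)]
    have hsq : √(N : ℝ) ^ 4 = N ^ 2 := by
      rw [show √(N : ℝ) ^ 4 = (√(N : ℝ) ^ 2) ^ 2 by ring, Real.sq_sqrt hN0.le]
    calc D ^ 4 ≤ _ := hD4
      _ ≤ (A * N : ℝ) ^ 2 * (2 * A * N * H ^ 2) * (44 * (q ^ 8 * B ^ 4)) := by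
          gcongr
          linarith
      _ = 88 * (A ^ 3 * N ^ 2 * H ^ 2 * q ^ 8 * B ^ 4) * N := by ring
      _ ≤ 88 * (A ^ 3 * N ^ 2 * H ^ 2 * q ^ 8 * B ^ 4) * (32 * A * q ^ 4) := by
          gcongr
          exact hA2'.trans (by gcongr)
      _ = 2816 * (A ^ 4 * N ^ 2 * q ^ 12 * B ^ 4) * H ^ 2 := by ring
      _ ≤ 65536 * (A ^ 4 * N ^ 2 * q ^ 12 * B ^ 4) * H ^ 4 := by
          gcongr <;> norm_num
      _ = (A * B * (32 * H * q ^ 3 / 2)) ^ 4 * N ^ 2 := by ring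
      _ = (A * B * (K * √N / 2)) ^ 4 := by rw [← hsq, hK]; ring
  have hAB : (0 : ℝ) < A * B := by positivity
  refine le_of_mul_le_mul_left (a := (A * B : ℝ)) ?_ hAB
  calc _ ≤ _ := hshift
    _ ≤ A * B * (K * √N / 2) + A * B * (2 * (K * √N / 4)) := by gcongr
    _ = _ := by ring

end Burgess

section PartialSummation

theorem abs_sum_Ioc_mul_le_of_antitone {f g : ℕ → ℝ} {K Y : ℝ} (hK : 0 ≤ K) (hY : 0 ≤ Y)
    (hf : ∀ M N : ℕ, |∑ n ∈ Finset.Ioc M (M + N), f n| ≤ K * √N)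
    (hg0 : ∀ n, 0 ≤ g n) (hg : ∀ n, 1 ≤ n → g (n + 1) ≤ g n)
    (hgY : ∀ n, g n * (n * √n) ≤ Y) {B Z : ℕ} (hB : 1 ≤ B) (hBZ : B ≤ Z) :
    |∑ c ∈ Finset.Ioc B Z, f c * g c| ≤ 2 * K * Y / B := by
  have hB0 : (0 : ℝ) < B := by exact_mod_cast hB
  have hF : ∀ n, B ≤ n → |∑ c ∈ Finset.Ioc B n, f c| ≤ K * √n := by
    intro n hn
    obtain ⟨k, rfl⟩ := Nat.exists_eq_add_of_le hn
    refine (hf B k).trans ?_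
    gcongr
    omega
  have key : |(∑ c ∈ Finset.Ioc B Z, f c * g c) - g Z * ∑ c ∈ Finset.Ioc B Z, f c|
      ≤ K * (Y * (2 / B - 1 / Z) - g Z * √Z) := by
    induction Z, hBZ using Nat.le_induction with
    | base =>
      simp only [Finset.Ioc_self, Finset.sum_empty, mul_zero, sub_zero, abs_zero]
      refine mul_nonneg hK ?_
      have h1 := hgY B
      rw [sub_nonneg, show (2 : ℝ) / B - 1 / B = 1 / B by ring, mul_one_div, le_div_iff₀ hB0]
      linarith
    | succ n hn ih =>
      have hn0 : (0 : ℝ) < n := by exact_mod_cast (by omega : 0 < n)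
      rw [Finset.sum_Ioc_succ_top (by omega), Finset.sum_Ioc_succ_top (by omega)]
      have e : (∑ c ∈ Finset.Ioc B n, f c * g c) + f (n + 1) * g (n + 1)
          - g (n + 1) * ((∑ c ∈ Finset.Ioc B n, f c) + f (n + 1))
          = ((∑ c ∈ Finset.Ioc B n, f c * g c) - g n * ∑ c ∈ Finset.Ioc B n, f c)
          + (g n - g (n + 1)) * ∑ c ∈ Finset.Ioc B n, f c := by ring
      rw [e]
      have h1 : |(g n - g (n + 1)) * ∑ c ∈ Finset.Ioc B n, f c|
          ≤ (g n - g (n + 1)) * (K * √n) := by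
        have h0 : 0 ≤ g n - g (n + 1) := sub_nonneg.2 (hg n (by omega))
        rw [abs_mul, abs_of_nonneg h0]
        exact mul_le_mul_of_nonneg_left (hF n hn) h0
      have hs0 : 0 < √((n + 1 : ℕ) : ℝ) := Real.sqrt_pos.2 (by positivity)
      have h2 : √((n + 1 : ℕ) : ℝ) - √n ≤ 1 / √((n + 1 : ℕ) : ℝ) := by
        rw [le_div_iff₀ hs0, sub_mul, Real.mul_self_sqrt (by positivity)]
        have : (n : ℝ) ≤ √n * √((n + 1 : ℕ) : ℝ) := by
          calc (n : ℝ) = √n * √n := (Real.mul_self_sqrt hn0.le).symm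
            _ ≤ _ := by gcongr; omega
        push_cast at this ⊢
        linarith
      have h3 : g (n + 1) * (√((n + 1 : ℕ) : ℝ) - √n) ≤ Y * (1 / n - 1 / (n + 1 : ℕ)) := by
        have h4 := hgY (n + 1)
        have h5 : g (n + 1) ≤ Y / (((n + 1 : ℕ) : ℝ) * √((n + 1 : ℕ) : ℝ)) := by
          rwa [le_div_iff₀ (by positivity)]
        calc _ ≤ Y / (((n + 1 : ℕ) : ℝ) * √((n + 1 : ℕ) : ℝ)) * (1 / √((n + 1 : ℕ) : ℝ)) :=
              (mul_le_mul_of_nonneg_left h2 (hg0 _)).trans (by gcongr)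
          _ = Y * (1 / (((n + 1 : ℕ) : ℝ) * (√((n + 1 : ℕ) : ℝ) * √((n + 1 : ℕ) : ℝ)))) := by
              field_simp
          _ ≤ Y * (1 / (((n + 1 : ℕ) : ℝ) * n)) := by
              rw [Real.mul_self_sqrt (by positivity)]
              gcongr
              omega
          _ = _ := by
              push_cast
              field_simp
              ring
      refine (abs_add_le _ _).trans ((add_le_add ih h1).trans ?_)
      have h6 := mul_le_mul_of_nonneg_left h3 hK
      linarith
  have h1 := hF Z hBZ
  have h2 : |g Z * ∑ c ∈ Finset.Ioc B Z, f c| ≤ g Z * (K * √Z) := by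
    rw [abs_mul, abs_of_nonneg (hg0 Z)]
    exact mul_le_mul_of_nonneg_left h1 (hg0 Z)
  have h3 : 0 ≤ K * Y * (1 / Z) := by positivity
  have h4 := abs_add_le ((∑ c ∈ Finset.Ioc B Z, f c * g c) - g Z * ∑ c ∈ Finset.Ioc B Z, f c)
    (g Z * ∑ c ∈ Finset.Ioc B Z, f c)
  rw [sub_add_cancel] at h4
  calc _ ≤ _ := h4
    _ ≤ K * (Y * (2 / B - 1 / Z) - g Z * √Z) + g Z * (K * √Z) := add_le_add key h2
    _ = 2 * K * Y / B - K * Y * (1 / Z) := by ring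
    _ ≤ _ := by linarith

/-- The weight `n ^ (-3 / 2)`. -/
noncomputable def invSqrtCube (n : ℕ) : ℝ := ((n : ℝ) * √n)⁻¹

theorem invSqrtCube_nonneg (n : ℕ) : 0 ≤ invSqrtCube n := by unfold invSqrtCube; positivity

theorem invSqrtCube_eq_rpow (n : ℕ) : invSqrtCube n = 1 / (n : ℝ) ^ (3 / 2 : ℝ) := by
  rcases Nat.eq_zero_or_pos n with rfl | hn
  · simp [invSqrtCube, Real.zero_rpow (by norm_num : (3 / 2 : ℝ) ≠ 0)]
  · have : (0 : ℝ) < n := by exact_mod_cast hn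
    rw [invSqrtCube, show (3 / 2 : ℝ) = 1 + 1 / 2 by norm_num, Real.rpow_add this, Real.rpow_one,
      ← Real.sqrt_eq_rpow, one_div]

theorem summable_invSqrtCube : Summable invSqrtCube := by
  have : invSqrtCube = fun n : ℕ => 1 / (n : ℝ) ^ (3 / 2 : ℝ) := funext invSqrtCube_eq_rpow
  rw [this]
  exact Real.summable_one_div_nat_rpow.2 (by norm_num)

theorem invSqrtCube_sq (n : ℕ) : invSqrtCube n ^ 2 = 1 / (n : ℝ) ^ 3 := by
  rw [invSqrtCube, inv_pow, mul_pow, Real.sq_sqrt (by positivity), one_div]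
  ring

theorem invSqrtCube_antitone {m n : ℕ} (hm : 1 ≤ m) (hmn : m ≤ n) :
    invSqrtCube n ≤ invSqrtCube m := by
  unfold invSqrtCube
  have : (0 : ℝ) < m := by exact_mod_cast hm
  gcongr

theorem invSqrtCube_le_one (n : ℕ) : invSqrtCube n ≤ 1 := by
  rcases Nat.eq_zero_or_pos n with rfl | hn
  · simp [invSqrtCube]
  · exact (invSqrtCube_antitone le_rfl hn).trans (by simp [invSqrtCube])

theorem invSqrtCube_mul_le (n : ℕ) : invSqrtCube n * (n * √n) ≤ 1 := by
  unfold invSqrtCube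
  rcases eq_or_ne ((n : ℝ) * √n) 0 with h | h
  · rw [h]; simp
  · rw [inv_mul_cancel₀ h]

theorem HasSum.tendsto_sum_Ioc_zero {g : ℕ → ℝ} {S : ℝ} (hg : HasSum g S) (h0 : g 0 = 0) :
    Filter.Tendsto (fun Z => ∑ n ∈ Finset.Ioc 0 Z, g n) Filter.atTop (nhds S) := by
  refine ((Filter.tendsto_add_atTop_iff_nat 1).2 hg.tendsto_sum_nat).congr fun Z => ?_
  rw [Finset.range_eq_Ico, Finset.sum_eq_sum_Ico_succ_bot (by omega), h0, _root_.zero_add]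
  rfl

theorem abs_tsum_sub_sum_Ioc_le {f : ℕ → ℝ} {K : ℝ} (hK : 0 ≤ K)
    (hf : ∀ M N : ℕ, |∑ n ∈ Finset.Ioc M (M + N), f n| ≤ K * √N)
    (hs : Summable fun n => f n * invSqrtCube n) {B : ℕ} (hB : 1 ≤ B) :
    |∑' n, f n * invSqrtCube n - ∑ n ∈ Finset.Ioc 0 B, f n * invSqrtCube n| ≤ 2 * K / B := by
  have h0 : f 0 * invSqrtCube 0 = 0 := by simp [invSqrtCube]
  have h2 : Filter.Tendsto (fun Z => |∑ n ∈ Finset.Ioc 0 Z, f n * invSqrtCube n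
      - ∑ n ∈ Finset.Ioc 0 B, f n * invSqrtCube n|) Filter.atTop
      (nhds |∑' n, f n * invSqrtCube n - ∑ n ∈ Finset.Ioc 0 B, f n * invSqrtCube n|) :=
    ((hs.hasSum.tendsto_sum_Ioc_zero h0).sub_const _).abs
  refine le_of_tendsto h2 (Filter.eventually_atTop.2 ⟨B, fun Z hZ => ?_⟩)
  rw [← Finset.sum_Ioc_consecutive _ (Nat.zero_le B) hZ, add_sub_cancel_left]
  have := abs_sum_Ioc_mul_le_of_antitone hK zero_le_one hf invSqrtCube_nonneg
    (fun n hn => invSqrtCube_antitone hn (Nat.le_succ n)) invSqrtCube_mul_le hB hZ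
  rwa [mul_one] at this

/-- The number of positive integers up to `t` not divisible by `p`. -/
noncomputable def countNotDvd (p : ℕ) (t : ℝ) : ℝ :=
  ((Finset.Ioc 0 ⌊t⌋₊).filter fun a => ¬ p ∣ a).card

theorem countNotDvd_nonneg (p : ℕ) (t : ℝ) : 0 ≤ countNotDvd p t := Nat.cast_nonneg _

theorem countNotDvd_mono (p : ℕ) {s t : ℝ} (h : s ≤ t) : countNotDvd p s ≤ countNotDvd p t := by
  unfold countNotDvd
  gcongr

theorem countNotDvd_le (p : ℕ) {t : ℝ} (ht : 0 ≤ t) : countNotDvd p t ≤ t := by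
  refine le_trans ?_ (Nat.floor_le ht)
  unfold countNotDvd
  exact_mod_cast (Finset.card_filter_le _ _).trans (by simp)

theorem countNotDvd_of_lt_one (p : ℕ) {t : ℝ} (ht : t < 1) : countNotDvd p t = 0 := by
  simp [countNotDvd, Nat.floor_eq_zero.2 ht]

theorem abs_countNotDvd_sub_le {p : ℕ} (hp : 0 < p) {t : ℝ} (ht : 0 ≤ t) :
    |countNotDvd p t - (1 - 1 / p) * t| ≤ 1 := by
  set m := ⌊t⌋₊ with hm
  have hp0 : (0 : ℝ) < p := by exact_mod_cast hp
  have h1 : countNotDvd p t = m - (m / p : ℕ) := by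
    have h2 := Finset.card_filter_add_card_filter_not (s := Finset.Ioc 0 m) (p ∣ ·)
    rw [Nat.Ioc_filter_dvd_card_eq_div, Nat.card_Ioc, Nat.sub_zero] at h2
    rw [countNotDvd, eq_sub_iff_add_eq, add_comm]
    exact_mod_cast h2
  have h3 : ((m / p : ℕ) : ℝ) ≤ m / p := Nat.cast_div_le
  have h4 : (m : ℝ) / p ≤ (m / p : ℕ) + 1 - 1 / p := by
    have h5 : m + 1 ≤ p * (m / p + 1) := Nat.lt_mul_div_succ m hp
    have h6 : (m + 1 : ℝ) ≤ p * ((m / p : ℕ) + 1) := by exact_mod_cast h5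
    have h7 : ((m : ℝ) + 1) / p ≤ (m / p : ℕ) + 1 := by rwa [div_le_iff₀' hp0]
    rw [add_div] at h7
    linarith
  have h5 := Nat.floor_le ht
  have h6 := Nat.lt_floor_add_one t
  rw [← hm] at h5 h6
  have hc : 0 ≤ 1 - 1 / (p : ℝ) := by
    rw [sub_nonneg, div_le_one hp0]
    exact_mod_cast hp
  have hc1 : 0 ≤ 1 / (p : ℝ) := by positivity
  have h7 := mul_le_mul_of_nonneg_left h5 hc
  have h8 := mul_le_mul_of_nonneg_left h6.le hc
  have h9 : (1 - 1 / (p : ℝ)) * m = m - m / p := by ring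
  rw [h1, abs_le]
  constructor <;> linarith

theorem abs_sum_mul_countNotDvd_sub_le {p : ℕ} (hp : 0 < p) {f : ℕ → ℝ} {κ : ℝ} (hκ : 1 ≤ κ)
    (hf1 : ∀ n, |f n| ≤ 1) (hf : ∀ M N : ℕ, |∑ n ∈ Finset.Ioc M (M + N), f n| ≤ κ ^ 2 * √N)
    {s : ℝ} (hs : 0 ≤ s) {Z : ℕ} (hZ : κ * s + 1 ≤ Z) :
    |∑ c ∈ Finset.Ioc 0 Z, f c * countNotDvd p (s ^ 2 * invSqrtCube c)
      - (1 - 1 / p) * (∑' n, f n * invSqrtCube n) * s ^ 2|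
      ≤ (6 + ∑' n, invSqrtCube n) * (κ * s) := by
  have hp0 : (0 : ℝ) < p := by exact_mod_cast hp
  have hc0 : 0 ≤ 1 - 1 / (p : ℝ) := by
    rw [sub_nonneg, div_le_one hp0]
    exact_mod_cast hp
  have hc1 : 1 - 1 / (p : ℝ) ≤ 1 := by
    have : 0 ≤ 1 / (p : ℝ) := by positivity
    linarith
  set δ := 1 - 1 / (p : ℝ) with hδ
  have hbd : ∀ n, ‖f n * invSqrtCube n‖ ≤ invSqrtCube n := by
    intro n
    rw [Real.norm_eq_abs, abs_mul, abs_of_nonneg (invSqrtCube_nonneg n)]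
    exact mul_le_of_le_one_left (invSqrtCube_nonneg n) (hf1 n)
  have hsum : Summable fun n => f n * invSqrtCube n :=
    Summable.of_norm_bounded summable_invSqrtCube hbd
  set L := ∑' n, f n * invSqrtCube n with hL
  set W := ∑' n, invSqrtCube n with hW
  have hLW : |L| ≤ W := tsum_of_norm_bounded summable_invSqrtCube.hasSum hbd
  have hW0 : 0 ≤ W := tsum_nonneg invSqrtCube_nonneg
  have hκs : 0 ≤ κ * s := by positivity
  rcases lt_or_ge s 1 with hs1 | hs1
  · have h0 : ∀ c ∈ Finset.Ioc 0 Z, f c * countNotDvd p (s ^ 2 * invSqrtCube c) = 0 := by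
      intro c _
      rw [countNotDvd_of_lt_one, mul_zero]
      have : s ^ 2 < 1 := pow_lt_one₀ hs hs1 (by norm_num)
      exact (mul_le_of_le_one_right (by positivity) (invSqrtCube_le_one c)).trans_lt this
    rw [Finset.sum_eq_zero h0, zero_sub, abs_neg, abs_mul, abs_mul, abs_of_nonneg hc0,
      abs_of_nonneg (sq_nonneg s)]
    calc δ * |L| * s ^ 2 ≤ 1 * W * s := by
          gcongr
          nlinarith
      _ ≤ 1 * W * (κ * s) := by
          gcongr
          exact le_mul_of_one_le_left hs hκ
      _ ≤ _ := by
          gcongr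
          linarith
  · set B := ⌈κ * s⌉₊ with hB
    have hκs1 : 1 ≤ κ * s := one_le_mul_of_one_le_of_one_le hκ hs1
    have hB1 : κ * s ≤ B := Nat.le_ceil _
    have hB2 : (B : ℝ) < κ * s + 1 := Nat.ceil_lt_add_one hκs
    have hB0 : (0 : ℝ) < B := by linarith
    have hB0' : 1 ≤ B := by exact_mod_cast hB0
    have hBZ : B ≤ Z := by
      have : (B : ℝ) ≤ Z := by linarith
      exact_mod_cast this
    have hg : |∑ c ∈ Finset.Ioc B Z, f c * countNotDvd p (s ^ 2 * invSqrtCube c)|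
        ≤ 2 * κ ^ 2 * s ^ 2 / B := by
      refine abs_sum_Ioc_mul_le_of_antitone (by positivity) (by positivity) hf
        (fun n => countNotDvd_nonneg _ _) (fun n hn => countNotDvd_mono _ ?_) (fun n => ?_) hB0' hBZ
      · have := invSqrtCube_antitone hn (Nat.le_succ n)
        gcongr
      · have h1 := invSqrtCube_nonneg n
        calc _ ≤ s ^ 2 * invSqrtCube n * (n * √n) := by
              gcongr
              exact countNotDvd_le _ (by positivity)
          _ = s ^ 2 * (invSqrtCube n * (n * √n)) := by ring
          _ ≤ s ^ 2 * 1 := by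
              gcongr
              exact invSqrtCube_mul_le n
          _ = _ := mul_one _
    have hLB := abs_tsum_sub_sum_Ioc_le (by positivity : 0 ≤ κ ^ 2) hf hsum hB0'
    have hmain : |∑ c ∈ Finset.Ioc 0 B, f c * (countNotDvd p (s ^ 2 * invSqrtCube c)
        - δ * (s ^ 2 * invSqrtCube c))| ≤ B := by
      calc _ ≤ ∑ c ∈ Finset.Ioc 0 B, (1 : ℝ) := by
            refine (Finset.abs_sum_le_sum_abs _ _).trans (Finset.sum_le_sum fun c _ => ?_)
            rw [abs_mul]
            have h1 := invSqrtCube_nonneg c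
            exact mul_le_one₀ (hf1 c) (abs_nonneg _) (abs_countNotDvd_sub_le hp (by positivity))
        _ = B := by simp
    have e : ∑ c ∈ Finset.Ioc 0 Z, f c * countNotDvd p (s ^ 2 * invSqrtCube c) - δ * L * s ^ 2
        = (∑ c ∈ Finset.Ioc 0 B, f c * (countNotDvd p (s ^ 2 * invSqrtCube c)
        - δ * (s ^ 2 * invSqrtCube c)))
        + (∑ c ∈ Finset.Ioc B Z, f c * countNotDvd p (s ^ 2 * invSqrtCube c))
        - δ * s ^ 2 * (L - ∑ n ∈ Finset.Ioc 0 B, f n * invSqrtCube n) := by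
      rw [← Finset.sum_Ioc_consecutive _ (Nat.zero_le B) hBZ]
      simp only [mul_sub, Finset.sum_sub_distrib, Finset.mul_sum]
      have : ∑ c ∈ Finset.Ioc 0 B, f c * (δ * (s ^ 2 * invSqrtCube c))
          = ∑ c ∈ Finset.Ioc 0 B, δ * s ^ 2 * (f c * invSqrtCube c) :=
        Finset.sum_congr rfl fun _ _ => by ring
      rw [this]
      ring
    have htail : |δ * s ^ 2 * (L - ∑ n ∈ Finset.Ioc 0 B, f n * invSqrtCube n)|
        ≤ 2 * κ ^ 2 * s ^ 2 / B := by
      rw [abs_mul, abs_of_nonneg (by positivity)]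
      calc _ ≤ 1 * s ^ 2 * (2 * κ ^ 2 / B) := by gcongr
        _ = _ := by ring
    have hq : 2 * κ ^ 2 * s ^ 2 / B ≤ 2 * (κ * s) := by
      rw [div_le_iff₀ hB0]
      nlinarith
    rw [e]
    refine (abs_sub _ _).trans ((add_le_add (abs_add_le _ _) le_rfl).trans ?_)
    have : 0 ≤ W * (κ * s) := by positivity
    linarith

end PartialSummation

section SquarefullNumbers

open ArithmeticFunction.Moebius in
theorem sum_moebius_of_sq_dvd {e Z : ℕ} (he : 0 < e) (hZ : e ≤ Z) :
    ∑ d ∈ Finset.Ioc 0 Z with d ^ 2 ∣ e, (μ d : ℤ) = if Squarefree e then 1 else 0 := by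
  obtain ⟨s, b, hsb, hs⟩ := Nat.sq_mul_squarefree e
  have hb : b ≠ 0 := by rintro rfl; simp at hsb; omega
  have hset : (Finset.Ioc 0 Z).filter (fun d => d ^ 2 ∣ e) = b.divisors := by
    ext d
    rw [Finset.mem_filter, Finset.mem_Ioc, Nat.mem_divisors]
    constructor
    · rintro ⟨⟨hd, _⟩, h⟩
      refine ⟨?_, hb⟩
      rw [← hsb] at h
      have hf := (Nat.factorization_le_iff_dvd (by positivity)
        (by rw [hsb]; omega)).2 h
      rw [← Nat.factorization_le_iff_dvd hd.ne' hb]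
      intro q
      have h1 := hf q
      have h2 := hs.natFactorization_le_one q
      rw [Nat.factorization_mul (by positivity) hs.ne_zero, Nat.factorization_pow,
        Nat.factorization_pow] at h1
      simp only [Finsupp.smul_apply, Finsupp.add_apply, smul_eq_mul] at h1
      omega
    · rintro ⟨h, _⟩
      have h1 : d ^ 2 ∣ e := (pow_dvd_pow_of_dvd h 2).trans ⟨s, hsb.symm⟩
      have h2 : 0 < d := Nat.pos_of_dvd_of_pos h (Nat.pos_of_ne_zero hb)
      refine ⟨⟨h2, ?_⟩, h1⟩
      have := Nat.le_of_dvd he h1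
      nlinarith
  rw [hset]
  have h3 := congrArg (fun f => f b) ArithmeticFunction.coe_zeta_mul_moebius
  simp only [ArithmeticFunction.coe_zeta_mul_apply, ArithmeticFunction.one_apply] at h3
  rw [h3]
  congr 1
  rw [eq_iff_iff]
  constructor
  · rintro rfl
    rw [← hsb]; simpa using hs
  · intro h
    have := h b ⟨s, by rw [← hsb]; ring⟩
    exact Nat.isUnit_iff.1 this

open ArithmeticFunction.Moebius in
theorem sum_moebius_mul_sum_sq_mul {Z : ℕ} (G : ℕ → ℝ) (hG : ∀ e, Z < e → G e = 0) :
    ∑ d ∈ Finset.Ioc 0 Z, (μ d : ℝ) * ∑ c ∈ Finset.Ioc 0 Z, G (d ^ 2 * c)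
      = ∑ e ∈ Finset.Ioc 0 Z, (if Squarefree e then 1 else 0) * G e := by
  have h1 : ∀ d ∈ Finset.Ioc 0 Z, ∑ c ∈ Finset.Ioc 0 Z, G (d ^ 2 * c)
      = ∑ e ∈ Finset.Ioc 0 Z, if d ^ 2 ∣ e then G e else 0 := by
    intro d hd
    have hd0 : 0 < d ^ 2 := pow_pos (Finset.mem_Ioc.1 hd).1 2
    have hinj : Set.InjOn (fun c => d ^ 2 * c) (Finset.Ioc 0 Z : Finset ℕ) :=
      fun a _ b _ h => Nat.eq_of_mul_eq_mul_left hd0 h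
    rw [← Finset.sum_image (f := G) hinj, ← Finset.sum_filter]
    symm
    refine Finset.sum_subset ?_ ?_
    · intro e he
      obtain ⟨h1, k, rfl⟩ := Finset.mem_filter.1 he
      rw [Finset.mem_Ioc] at h1
      refine Finset.mem_image.2 ⟨k, Finset.mem_Ioc.2 ⟨?_, ?_⟩, rfl⟩
      · exact Nat.pos_of_mul_pos_left h1.1
      · nlinarith
    · intro e he hne
      obtain ⟨c, hc, rfl⟩ := Finset.mem_image.1 he
      refine hG _ (lt_of_not_ge fun h => hne ?_)
      refine Finset.mem_filter.2 ⟨Finset.mem_Ioc.2 ⟨?_, h⟩, dvd_mul_right _ _⟩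
      exact Nat.mul_pos hd0 (Finset.mem_Ioc.1 hc).1
  rw [Finset.sum_congr rfl fun d hd => by rw [h1 d hd]]
  simp_rw [Finset.mul_sum]
  rw [Finset.sum_comm]
  refine Finset.sum_congr rfl fun e he => ?_
  rw [Finset.mem_Ioc] at he
  have h2 := congrArg (Int.cast : ℤ → ℝ) (sum_moebius_of_sq_dvd he.1 he.2)
  rw [Finset.sum_filter] at h2
  push_cast at h2
  rw [← h2, Finset.sum_mul]
  refine Finset.sum_congr rfl fun d _ => ?_
  split_ifs <;> simp

theorem eq_of_sq_mul_cube_eq {a b e f : ℕ} (ha : 0 < a) (hb : 0 < b) (he : Squarefree e)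
    (hf : Squarefree f) (h : a ^ 2 * e ^ 3 = b ^ 2 * f ^ 3) : a = b ∧ e = f := by
  have hef : e = f := by
    refine Nat.eq_of_factorization_eq he.ne_zero hf.ne_zero fun q => ?_
    have h1 : (a ^ 2 * e ^ 3).factorization q = (b ^ 2 * f ^ 3).factorization q := by rw [h]
    have h2 := he.natFactorization_le_one q
    have h3 := hf.natFactorization_le_one q
    rw [Nat.factorization_mul (by positivity) (pow_ne_zero _ he.ne_zero),
      Nat.factorization_mul (by positivity) (pow_ne_zero _ hf.ne_zero)] at h1
    simp only [Nat.factorization_pow, Finsupp.smul_apply, Finsupp.add_apply, smul_eq_mul] at h1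
    omega
  subst hef
  have he0 : 0 < e ^ 3 := pow_pos (Nat.pos_of_ne_zero he.ne_zero) 3
  exact ⟨Nat.pow_left_injective two_ne_zero (Nat.eq_of_mul_eq_mul_right he0 h), rfl⟩

theorem squarefull_sq_mul_cube (a e : ℕ) : Squarefull (a ^ 2 * e ^ 3) := by
  intro q hq h
  rcases (Nat.Prime.dvd_mul hq).1 h with h | h
  · exact (pow_dvd_pow_of_dvd (hq.dvd_of_dvd_pow h) 2).mul_right _
  · refine Dvd.dvd.mul_left ?_ _
    exact (pow_dvd_pow_of_dvd (hq.dvd_of_dvd_pow h) 2).trans (pow_dvd_pow e (by norm_num))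

theorem Squarefull.exists_eq_sq_mul_cube {m : ℕ} (hm : 0 < m) (h : Squarefull m) :
    ∃ a e, 0 < a ∧ Squarefree e ∧ m = a ^ 2 * e ^ 3 := by
  obtain ⟨e, b, hb, he⟩ := Nat.sq_mul_squarefree m
  have hb0 : b ≠ 0 := by rintro rfl; simp at hb; omega
  have hdvd : e ∣ b := by
    rw [← Nat.factorization_le_iff_dvd he.ne_zero hb0]
    intro q
    by_cases hq : q.Prime
    · have h1 := he.natFactorization_le_one q
      rcases Nat.eq_zero_or_pos (e.factorization q) with h0 | h0
      · omega
      · have hqe : q ∣ e := Nat.dvd_of_factorization_pos h0.ne'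
        have hqm := h q hq (hqe.trans ⟨b ^ 2, by rw [← hb]; ring⟩)
        rw [hq.pow_dvd_iff_le_factorization hm.ne', ← hb, Nat.factorization_mul (by positivity)
          he.ne_zero, Nat.factorization_pow] at hqm
        simp only [Finsupp.smul_apply, Finsupp.add_apply, smul_eq_mul] at hqm
        omega
    · rw [Nat.factorization_eq_zero_of_not_prime _ hq]; omega
  obtain ⟨k, rfl⟩ := hdvd
  refine ⟨k, e, Nat.pos_of_ne_zero fun h => hb0 (by rw [h, mul_zero]), he, ?_⟩
  rw [← hb]; ring

open Classical in
theorem sum_squarefull_eq {X Z : ℕ} (hXZ : X ≤ Z) (F : ℕ → ℝ) :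
    ∑ m ∈ Finset.Icc 1 X, (if Squarefull m then F m else 0)
      = ∑ e ∈ Finset.Ioc 0 Z, (if Squarefree e then 1 else 0) *
        ∑ a ∈ Finset.Ioc 0 Z, if a ^ 2 * e ^ 3 ≤ X then F (a ^ 2 * e ^ 3) else 0 := by
  have h1 : ∑ e ∈ Finset.Ioc 0 Z, (if Squarefree e then (1 : ℝ) else 0) *
        ∑ a ∈ Finset.Ioc 0 Z, (if a ^ 2 * e ^ 3 ≤ X then F (a ^ 2 * e ^ 3) else 0)
      = ∑ u ∈ (Finset.Ioc 0 Z ×ˢ Finset.Ioc 0 Z).filter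
        (fun u => Squarefree u.1 ∧ u.2 ^ 2 * u.1 ^ 3 ≤ X), F (u.2 ^ 2 * u.1 ^ 3) := by
    rw [Finset.sum_filter, Finset.sum_product]
    refine Finset.sum_congr rfl fun e _ => ?_
    rw [Finset.mul_sum]
    refine Finset.sum_congr rfl fun a _ => ?_
    by_cases h1 : Squarefree e <;> by_cases h2 : a ^ 2 * e ^ 3 ≤ X <;> simp [h1, h2]
  rw [h1, ← Finset.sum_filter]
  symm
  refine Finset.sum_nbij (fun u => u.2 ^ 2 * u.1 ^ 3) ?_ ?_ ?_ fun _ _ => rfl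
  · intro u hu
    simp only [Finset.mem_filter, Finset.mem_product, Finset.mem_Ioc] at hu
    refine Finset.mem_filter.2 ⟨Finset.mem_Icc.2 ⟨?_, hu.2.2⟩, squarefull_sq_mul_cube _ _⟩
    exact Nat.mul_pos (pow_pos hu.1.2.1 2) (pow_pos hu.1.1.1 3)
  · intro u hu v hv h
    simp only [Finset.coe_filter, Finset.mem_product, Finset.mem_Ioc, Set.mem_ofPred_eq] at hu hv
    have := eq_of_sq_mul_cube_eq hu.1.2.1 hv.1.2.1 hu.2.1 hv.2.1 h
    exact Prod.ext this.2 this.1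
  · intro m hm
    simp only [Finset.coe_filter, Finset.mem_Icc, Set.mem_ofPred_eq] at hm
    obtain ⟨a, e, ha, he, rfl⟩ := hm.2.exists_eq_sq_mul_cube hm.1.1
    have he0 := Nat.pos_of_ne_zero he.ne_zero
    refine ⟨(e, a), ?_, rfl⟩
    simp only [Finset.coe_filter, Finset.mem_product, Finset.mem_Ioc, Set.mem_ofPred_eq]
    refine ⟨⟨⟨he0, ?_⟩, ha, ?_⟩, he, hm.1.2⟩
    · have h2 : e ≤ a ^ 2 * e ^ 3 :=
        (Nat.le_self_pow (by norm_num) e).trans (Nat.le_mul_of_pos_left _ (pow_pos ha 2))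
      omega
    · have h2 : a ≤ a ^ 2 * e ^ 3 :=
        (Nat.le_self_pow (by norm_num) a).trans (Nat.le_mul_of_pos_right _ (pow_pos he0 3))
      omega

variable {p : ℕ} [Fact p.Prime]

theorem realQuadChar_sq (x : ZMod p) : realQuadChar p x ^ 2 = if x = 0 then 0 else 1 := by
  split_ifs with h
  · rw [h, MulChar.map_zero]; norm_num
  · rw [← sq_abs, abs_realQuadChar_of_ne_zero h, one_pow]

theorem sum_realQuadChar_sq_mul_cube {s : ℝ} {Z : ℕ} (hZ : ⌊s ^ 4⌋₊ ≤ Z) {d c : ℕ}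
    (hd : 0 < d) (hc : 0 < c) :
    ∑ a ∈ Finset.Ioc 0 Z, (if a ^ 2 * (d ^ 2 * c) ^ 3 ≤ ⌊s ^ 4⌋₊ then
        realQuadChar p ((a ^ 2 * (d ^ 2 * c) ^ 3 : ℕ) : ZMod p) else 0)
      = (if p ∣ d then 0 else 1) * (realQuadChar p (c : ZMod p) *
        countNotDvd p ((s * invSqrtCube d) ^ 2 * invSqrtCube c)) := by
  have hd0 : (0 : ℝ) < d := by exact_mod_cast hd
  have hc0 : (0 : ℝ) < c := by exact_mod_cast hc
  have hw := invSqrtCube_nonneg c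
  have hval : ∀ a : ℕ, realQuadChar p ((a ^ 2 * (d ^ 2 * c) ^ 3 : ℕ) : ZMod p)
      = (if p ∣ d then 0 else 1) * realQuadChar p (c : ZMod p) * (if ¬ p ∣ a then 1 else 0) := by
    intro a
    push_cast
    simp only [map_mul, map_pow]
    have h1 := realQuadChar_sq (a : ZMod p)
    have h2 := realQuadChar_sq (d : ZMod p)
    have h3 := realQuadChar_sq (c : ZMod p)
    have hc3 : realQuadChar p (c : ZMod p) ^ 3 = realQuadChar p (c : ZMod p) := by
      rw [pow_succ, h3]
      split_ifs with h
      · rw [h, MulChar.map_zero, zero_mul]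
      · rw [one_mul]
    simp only [ZMod.natCast_eq_zero_iff] at h1 h2
    rw [h2, mul_pow, hc3, h1]
    by_cases h4 : p ∣ d <;> by_cases h5 : p ∣ a <;> simp [h4, h5]
  have hcond : ∀ a : ℕ, a ^ 2 * (d ^ 2 * c) ^ 3 ≤ ⌊s ^ 4⌋₊ ↔
      a ≤ ⌊(s * invSqrtCube d) ^ 2 * invSqrtCube c⌋₊ := by
    intro a
    rw [Nat.le_floor_iff (by positivity), Nat.le_floor_iff (by positivity)]
    rw [mul_pow s, invSqrtCube_sq, ← pow_le_pow_iff_left₀ (a := (a : ℝ)) (Nat.cast_nonneg a)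
      (by positivity) two_ne_zero]
    have e : (s ^ 2 * (1 / (d : ℝ) ^ 3) * invSqrtCube c) ^ 2 = s ^ 4 / (d ^ 6 * c ^ 3) := by
      rw [mul_pow, invSqrtCube_sq]
      field_simp
    rw [e, le_div_iff₀ (by positivity)]
    push_cast
    rw [show ((a : ℝ) ^ 2 * (d ^ 2 * c) ^ 3) = a ^ 2 * (d ^ 6 * c ^ 3) by ring]
  have hset : (Finset.Ioc 0 Z).filter (fun a => a ^ 2 * (d ^ 2 * c) ^ 3 ≤ ⌊s ^ 4⌋₊)
      = Finset.Ioc 0 ⌊(s * invSqrtCube d) ^ 2 * invSqrtCube c⌋₊ := by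
    ext a
    rw [Finset.mem_filter, hcond a, Finset.mem_Ioc, Finset.mem_Ioc]
    refine ⟨fun h => ⟨h.1.1, h.2⟩, fun h => ⟨⟨h.1, ?_⟩, h.2⟩⟩
    have h2 : a ≤ a ^ 2 * (d ^ 2 * c) ^ 3 :=
        (Nat.le_self_pow (by norm_num) a).trans (Nat.le_mul_of_pos_right _ (by positivity))
    exact h2.trans (((hcond a).2 h.2).trans hZ)
  rw [← Finset.sum_filter, hset, Finset.sum_congr rfl fun a _ => hval a, ← Finset.mul_sum,
    Finset.sum_boole, countNotDvd, mul_assoc]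

open Classical ArithmeticFunction.Moebius in
theorem sum_squarefull_realQuadChar_eq {s : ℝ} {Z : ℕ} (hZ : ⌊s ^ 4⌋₊ ≤ Z) :
    ∑ m ∈ Finset.Icc 1 ⌊s ^ 4⌋₊, (if Squarefull m then realQuadChar p (m : ZMod p) else 0)
      = ∑ d ∈ Finset.Ioc 0 Z, (μ d : ℝ) * (if p ∣ d then 0 else 1) *
        ∑ c ∈ Finset.Ioc 0 Z, realQuadChar p (c : ZMod p) *
          countNotDvd p ((s * invSqrtCube d) ^ 2 * invSqrtCube c) := by
  rw [sum_squarefull_eq hZ fun m => realQuadChar p (m : ZMod p), ← sum_moebius_mul_sum_sq_mul]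
  · refine Finset.sum_congr rfl fun d hd => ?_
    rw [mul_assoc, Finset.mul_sum (a := if p ∣ d then (0 : ℝ) else 1)]
    congr 1
    refine Finset.sum_congr rfl fun c hc => ?_
    exact sum_realQuadChar_sq_mul_cube hZ (Finset.mem_Ioc.1 hd).1 (Finset.mem_Ioc.1 hc).1
  · intro e he
    refine Finset.sum_eq_zero fun a ha => if_neg ?_
    have h2 : e ≤ a ^ 2 * e ^ 3 :=
        (Nat.le_self_pow (by norm_num) e).trans
          (Nat.le_mul_of_pos_left _ (pow_pos (Finset.mem_Ioc.1 ha).1 2))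
    omega

end SquarefullNumbers

section SquarefullSum

variable {p : ℕ} [Fact p.Prime]

theorem summable_moebius_mul_inv_cube (p : ℕ) : Summable fun d : ℕ =>
    (ArithmeticFunction.moebius d : ℝ) * (if p ∣ d then 0 else 1) * invSqrtCube d ^ 2 := by
  refine Summable.of_norm_bounded summable_invSqrtCube fun d => ?_
  have h0 := invSqrtCube_nonneg d
  have h1 : |(ArithmeticFunction.moebius d : ℝ)| ≤ 1 := by
    exact_mod_cast ArithmeticFunction.abs_moebius_le_one
  have h2 : |(if p ∣ d then 0 else 1 : ℝ)| ≤ 1 := by split_ifs <;> simp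
  rw [Real.norm_eq_abs, abs_mul, abs_mul, abs_of_nonneg (sq_nonneg (invSqrtCube d))]
  calc _ ≤ 1 * 1 * (invSqrtCube d * 1) := by
        rw [sq]
        gcongr
        exact invSqrtCube_le_one d
    _ = _ := by ring

open Classical in
theorem abs_sum_squarefull_realQuadChar_sub_le (hp : p ≠ 2) {s : ℝ} (hs : 0 ≤ s) :
    |∑ m ∈ Finset.Icc 1 ⌊s ^ 4⌋₊, (if Squarefull m then realQuadChar p (m : ZMod p) else 0)
      - (1 - 1 / p) * (∑' n : ℕ, realQuadChar p (n : ZMod p) * invSqrtCube n) * s ^ 2 *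
        ∑' d : ℕ, (ArithmeticFunction.moebius d : ℝ) * (if p ∣ d then 0 else 1)
          * invSqrtCube d ^ 2|
      ≤ (6 + ∑' n, invSqrtCube n) * (∑' n, invSqrtCube n) *
        (√(32 * (1 + Real.log p) * (p : ℝ) ^ (3 / 16 : ℝ)) * s) := by
  have hp1 : (1 : ℝ) ≤ p := by exact_mod_cast (Fact.out : p.Prime).one_lt.le
  have hlog : 0 ≤ Real.log (p : ℝ) := Real.log_natCast_nonneg p
  set κ := √(32 * (1 + Real.log p) * (p : ℝ) ^ (3 / 16 : ℝ)) with hκ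
  have hκ2 : κ ^ 2 = 32 * (1 + Real.log p) * (p : ℝ) ^ (3 / 16 : ℝ) := Real.sq_sqrt (by positivity)
  have hκ1 : 1 ≤ κ := by
    rw [hκ, Real.one_le_sqrt]
    have h1 : 1 ≤ (p : ℝ) ^ (3 / 16 : ℝ) := Real.one_le_rpow hp1 (by norm_num)
    have h2 : 1 ≤ 32 * (1 + Real.log p) := by linarith
    exact one_le_mul_of_one_le_of_one_le h2 h1
  set f : ℕ → ℝ := fun n => realQuadChar p (n : ZMod p) with hf
  have hfb : ∀ M N : ℕ, |∑ n ∈ Finset.Ioc M (M + N), f n| ≤ κ ^ 2 * √N := by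
    intro M N
    rw [hκ2]
    exact abs_sum_Ioc_realQuadChar_le hp M N
  set W := ∑' n, invSqrtCube n with hW
  have hW0 : 0 ≤ W := tsum_nonneg invSqrtCube_nonneg
  set δ := 1 - 1 / (p : ℝ) with hδ
  set L := ∑' n, f n * invSqrtCube n with hL
  set e : ℕ → ℝ := fun d => (ArithmeticFunction.moebius d : ℝ) * (if p ∣ d then 0 else 1) with he
  have he1 : ∀ d, |e d| ≤ 1 := by
    intro d
    have h1 : |(ArithmeticFunction.moebius d : ℝ)| ≤ 1 := by
      exact_mod_cast ArithmeticFunction.abs_moebius_le_one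
    simp only [he]
    split_ifs <;> simp [h1]
  have hsum : HasSum (fun d => e d * invSqrtCube d ^ 2) (∑' d, e d * invSqrtCube d ^ 2) :=
    (summable_moebius_mul_inv_cube p).hasSum
  have htend := hsum.tendsto_sum_Ioc_zero (by simp [invSqrtCube])
  refine le_of_tendsto ((htend.const_mul (δ * L * s ^ 2)).const_sub _).abs
    (Filter.eventually_atTop.2 ⟨max ⌊s ^ 4⌋₊ ⌈κ * s + 1⌉₊, fun Z hZ => ?_⟩)
  have hZ1 : ⌊s ^ 4⌋₊ ≤ Z := (le_max_left _ _).trans hZ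
  have hZ2 : κ * s + 1 ≤ Z := Nat.ceil_le.1 ((le_max_right _ _).trans hZ)
  rw [sum_squarefull_realQuadChar_eq hZ1, Finset.mul_sum, ← Finset.sum_sub_distrib]
  calc _ ≤ ∑ d ∈ Finset.Ioc 0 Z, (6 + W) * (κ * (s * invSqrtCube d)) := by
        refine (Finset.abs_sum_le_sum_abs _ _).trans (Finset.sum_le_sum fun d _ => ?_)
        have h0 := invSqrtCube_nonneg d
        have h1 : κ * (s * invSqrtCube d) + 1 ≤ Z := by
          have : κ * (s * invSqrtCube d) ≤ κ * (s * 1) := by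
            gcongr
            exact invSqrtCube_le_one d
          linarith
        have h2 := abs_sum_mul_countNotDvd_sub_le (Fact.out : p.Prime).pos hκ1
          (fun n => abs_realQuadChar_le_one (n : ZMod p)) hfb (by positivity) h1
        rw [show ∀ T : ℝ, (ArithmeticFunction.moebius d : ℝ) * (if p ∣ d then 0 else 1) * T
          - δ * L * s ^ 2 * (e d * invSqrtCube d ^ 2)
          = e d * (T - δ * L * (s * invSqrtCube d) ^ 2) from fun T => by simp only [he]; ring,
          abs_mul]
        exact (mul_le_of_le_one_left (abs_nonneg _) (he1 d)).trans h2
    _ = (6 + W) * (κ * s) * ∑ d ∈ Finset.Ioc 0 Z, invSqrtCube d := by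
        rw [Finset.mul_sum]
        exact Finset.sum_congr rfl fun _ _ => by ring
    _ ≤ (6 + W) * (κ * s) * W := by
        gcongr
        exact summable_invSqrtCube.sum_le_tsum _ fun n _ => invSqrtCube_nonneg n
    _ = _ := by ring

theorem DirichletCharacter.eq_realQuadChar {χ : DirichletCharacter ℂ p} (h1 : χ ≠ 1)
    (h2 : χ ^ 2 = 1) (x : ZMod p) : χ x = (realQuadChar p x : ℂ) := by
  have hsq : ∀ y : ZMod p, y ≠ 0 → χ y * χ y = 1 := by
    intro y hy
    have := congrArg (fun ψ => ψ y) h2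
    simp only [MulChar.pow_apply' χ two_ne_zero, MulChar.one_apply hy.isUnit] at this
    rw [← this, sq]
  obtain ⟨u, hu⟩ := MulChar.ne_one_iff.1 h1
  have hu1 : χ u = -1 := (mul_self_eq_one_iff.1 (hsq u u.ne_zero)).resolve_left hu
  have hsquare : ∀ y : ZMod p, y ≠ 0 → quadraticChar (ZMod p) y = 1 → χ y = 1 := by
    intro y hy h
    obtain ⟨z, rfl⟩ := (quadraticChar_one_iff_isSquare hy).1 h
    rw [map_mul]
    exact hsq z (left_ne_zero_of_mul hy)
  have hqu : quadraticChar (ZMod p) (u : ZMod p) = -1 :=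
    (quadraticChar_dichotomy u.ne_zero).resolve_left fun h => hu (hsquare u u.ne_zero h)
  rw [realQuadChar_apply]
  by_cases hx : x = 0
  · rw [hx, MulChar.map_zero, MulChar.map_zero]; simp
  rcases quadraticChar_dichotomy hx with h | h
  · rw [h, hsquare x hx h]; simp
  · have h3 := hsquare (x * u) (mul_ne_zero hx u.ne_zero) (by rw [map_mul, h, hqu]; norm_num)
    rw [map_mul, hu1] at h3
    rw [h]
    push_cast
    linear_combination -h3

theorem LFunction_three_halves_eq_ofReal {χ : DirichletCharacter ℂ p} (h1 : χ ≠ 1)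
    (h2 : χ ^ 2 = 1) : DirichletCharacter.LFunction χ (3 / 2)
      = ((∑' n : ℕ, realQuadChar p (n : ZMod p) * invSqrtCube n : ℝ) : ℂ) := by
  rw [DirichletCharacter.LFunction_eq_LSeries χ (by norm_num), LSeries, Complex.ofReal_tsum]
  refine tsum_congr fun n => ?_
  rcases eq_or_ne n 0 with rfl | hn
  · simp [invSqrtCube]
  · rw [LSeries.term_of_ne_zero hn, DirichletCharacter.eq_realQuadChar h1 h2, invSqrtCube_eq_rpow]
    push_cast
    rw [Complex.ofReal_cpow (Nat.cast_nonneg n)]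
    push_cast
    rw [mul_one_div]

theorem ofReal_tsum_moebius_mul_eq : ((∑' d : ℕ, (ArithmeticFunction.moebius d : ℝ) *
      (if p ∣ d then 0 else 1) * invSqrtCube d ^ 2 : ℝ) : ℂ) * ((1 - 1 / (p : ℂ) ^ 3)
        * riemannZeta 3) = 1 := by
  have h1 := DirichletCharacter.LSeries.mul_mu_eq_one (1 : DirichletCharacter ℂ p)
    (s := 3) (by norm_num)
  rw [← DirichletCharacter.LFunction_eq_LSeries _ (by norm_num)] at h1
  have h2 := DirichletCharacter.LFunctionTrivChar_eq_mul_riemannZeta (N := p) (s := 3)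
    (by norm_num)
  rw [(Fact.out : p.Prime).primeFactors, Finset.prod_singleton] at h2
  rw [DirichletCharacter.LFunctionTrivChar] at h2
  rw [h2, mul_comm] at h1
  refine Eq.trans ?_ h1
  congr 1
  · rw [LSeries, Complex.ofReal_tsum]
    refine tsum_congr fun n => ?_
    rcases eq_or_ne n 0 with rfl | hn
    · simp [invSqrtCube]
    · rw [LSeries.term_of_ne_zero hn, invSqrtCube_sq]
      have h3 : (1 : DirichletCharacter ℂ p) (n : ZMod p) = if p ∣ n then 0 else 1 := by
        split_ifs with h
        · rw [(ZMod.natCast_eq_zero_iff n p).2 h, MulChar.map_zero]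
        · refine MulChar.one_apply (Ne.isUnit ?_)
          rwa [Ne, ZMod.natCast_eq_zero_iff]
      simp only [Pi.mul_apply, h3]
      rw [show (3 : ℂ) = ((3 : ℕ) : ℂ) by norm_num, Complex.cpow_natCast]
      split_ifs <;> simp [div_eq_mul_inv]
  · rw [show (-3 : ℂ) = -((3 : ℕ) : ℂ) by norm_num, Complex.cpow_neg, Complex.cpow_natCast, one_div]

theorem sqrt_mul_log_mul_rpow_le {ε : ℝ} (hε : 0 < ε) {p : ℝ} (hp : 1 ≤ p) :
    √(32 * (1 + Real.log p) * p ^ (3 / 16 : ℝ))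
      ≤ √(32 * (1 + 1 / (2 * ε))) * p ^ ((3 : ℝ) / 32 + ε) := by
  have hp0 : 0 < p := by linarith
  have h1 : Real.log p ≤ p ^ (2 * ε) / (2 * ε) := Real.log_le_rpow_div hp0.le (by positivity)
  have h2 : 1 ≤ p ^ (2 * ε) := Real.one_le_rpow hp (by positivity)
  rw [Real.sqrt_le_left (by positivity), mul_pow, Real.sq_sqrt (by positivity),
    ← Real.rpow_natCast, ← Real.rpow_mul hp0.le]
  have h3 : p ^ (((3 : ℝ) / 32 + ε) * (2 : ℕ)) = p ^ (2 * ε) * p ^ (3 / 16 : ℝ) := by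
    rw [← Real.rpow_add hp0]
    congr 1
    push_cast
    ring
  rw [h3, ← mul_assoc, mul_assoc 32 (1 + 1 / (2 * ε))]
  gcongr
  calc 1 + Real.log p ≤ p ^ (2 * ε) + p ^ (2 * ε) / (2 * ε) := add_le_add h2 h1
    _ = _ := by ring

end SquarefullSum

open Classical in
/-- Quadratic character case of Lemma 2: for the quadratic character `χ` mod `p`, the sum of
`χ` over square-full integers up to `x` equals `(L(3/2,χ)/ζ(3)) (1 + 1/p + 1/p²)⁻¹ x^(1/2)`
up to an error `O(x^(1/4) (log x)^(1/2) p^(3/32+ε))`. -/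
theorem squarefull_char_sum_quadratic :
    ∀ ε : ℝ, 0 < ε → ∃ C : ℝ, 0 < C ∧ ∀ (p : ℕ) [Fact p.Prime], Odd p →
      ∀ χ : DirichletCharacter ℂ p, χ ≠ 1 → χ ^ 2 = 1 →
      ∀ x : ℝ, 2 ≤ x →
        ‖(∑ m ∈ Finset.Icc 1 ⌊x⌋₊, if Squarefull m then χ (m : ZMod p) else 0)
            - DirichletCharacter.LFunction χ (3/2) / riemannZeta 3
              * ((1 + 1 / (p : ℝ) + 1 / (p : ℝ) ^ 2)⁻¹ : ℝ) * ((x ^ ((1 : ℝ)/2) : ℝ) : ℂ)‖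
          ≤ C * x ^ ((1 : ℝ)/4) * (Real.log x) ^ ((1 : ℝ)/2) * (p : ℝ) ^ ((3 : ℝ)/32 + ε) := by
  intro ε hε
  set W := ∑' n, invSqrtCube n with hW
  have hW0 : 0 ≤ W := tsum_nonneg invSqrtCube_nonneg
  have hlog2 : 0 < Real.log 2 := Real.log_pos one_lt_two
  refine ⟨(6 + W) * (W + 1) * √(32 * (1 + 1 / (2 * ε))) / Real.log 2 ^ ((1 : ℝ) / 2),
    by positivity, ?_⟩
  intro p _ hodd χ h1 h2 x hx
  have hp2 : p ≠ 2 := by rintro rfl; exact absurd hodd (by decide)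
  have hp1 : (1 : ℝ) < p := by exact_mod_cast (Fact.out : p.Prime).one_lt
  have hx0 : 0 ≤ x := by linarith
  set s := x ^ ((1 : ℝ) / 4) with hs
  have hs0 : 0 ≤ s := by positivity
  have hs4 : s ^ 4 = x := by
    rw [hs, ← Real.rpow_natCast, ← Real.rpow_mul hx0]; norm_num
  have hs2 : x ^ ((1 : ℝ) / 2) = s ^ 2 := by
    rw [hs, ← Real.rpow_natCast, ← Real.rpow_mul hx0]; norm_num
  have hreal := abs_sum_squarefull_realQuadChar_sub_le hp2 hs0
  rw [hs4, ← hW] at hreal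
  have hζ : riemannZeta 3 ≠ 0 := riemannZeta_ne_zero_of_one_lt_re (by norm_num)
  have hM := ofReal_tsum_moebius_mul_eq (p := p)
  set D := ∑' d : ℕ, (ArithmeticFunction.moebius d : ℝ) * (if p ∣ d then 0 else 1)
    * invSqrtCube d ^ 2 with hD
  set L := ∑' n : ℕ, realQuadChar p (n : ZMod p) * invSqrtCube n with hL
  have hpoly : (1 + 1 / (p : ℝ) + 1 / (p : ℝ) ^ 2) ≠ 0 := by positivity
  have hpolyC : (1 + 1 / (p : ℂ) + 1 / (p : ℂ) ^ 2) ≠ 0 := by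
    have := Complex.ofReal_ne_zero.2 hpoly
    push_cast at this
    exact this
  have hmain : DirichletCharacter.LFunction χ (3 / 2) / riemannZeta 3
      * ((1 + 1 / (p : ℝ) + 1 / (p : ℝ) ^ 2)⁻¹ : ℝ) * ((x ^ ((1 : ℝ) / 2) : ℝ) : ℂ)
      = (((1 - 1 / p) * L * s ^ 2 * D : ℝ) : ℂ) := by
    rw [LFunction_three_halves_eq_ofReal h1 h2, ← hL, hs2]
    push_cast
    rw [← div_eq_mul_inv, div_div, div_mul_eq_mul_div, div_eq_iff (mul_ne_zero hζ hpolyC)]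
    linear_combination -(L : ℂ) * s ^ 2 * hM
  have hsum : (∑ m ∈ Finset.Icc 1 ⌊x⌋₊, if Squarefull m then χ (m : ZMod p) else 0)
      = ((∑ m ∈ Finset.Icc 1 ⌊x⌋₊,
        (if Squarefull m then realQuadChar p (m : ZMod p) else 0) : ℝ) : ℂ) := by
    rw [Complex.ofReal_sum]
    refine Finset.sum_congr rfl fun m _ => ?_
    split_ifs
    · exact DirichletCharacter.eq_realQuadChar h1 h2 _
    · simp
  rw [hmain, hsum, ← Complex.ofReal_sub, Complex.norm_real, Real.norm_eq_abs]
  have hκ := sqrt_mul_log_mul_rpow_le hε hp1.le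
  have hlogx : 1 ≤ (Real.log x) ^ ((1 : ℝ) / 2) / Real.log 2 ^ ((1 : ℝ) / 2) := by
    rw [one_le_div (by positivity)]
    gcongr
  calc _ ≤ (6 + W) * W * (√(32 * (1 + Real.log p) * (p : ℝ) ^ (3 / 16 : ℝ)) * s) := hreal
    _ ≤ (6 + W) * (W + 1) * ((√(32 * (1 + 1 / (2 * ε))) * p ^ ((3 : ℝ) / 32 + ε)) * s) * 1 := by
        rw [mul_one]
        gcongr
        linarith
    _ ≤ (6 + W) * (W + 1) * ((√(32 * (1 + 1 / (2 * ε))) * p ^ ((3 : ℝ) / 32 + ε)) * s)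
        * ((Real.log x) ^ ((1 : ℝ) / 2) / Real.log 2 ^ ((1 : ℝ) / 2)) := by gcongr
    _ = _ := by ring
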